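/- arXiv:1202.5838 — 2 statements merged into one kernel-verified Lean document; each statement's English description precedes it below -/
import Mathlib

section
/- Let $f=(f_n)_{n\in\mathbb{N}}$ be a sequence of measurable functions on $\mathbb{R}^d$ and let $1<q<+\infty$. If the function $x\mapsto\left(\sum_{n=0}^{\infty}|f_n(x)|^q\right)^{1/q}$ belongs to $L^1(\mathbb{R}^d)$, then there is a constant $C=C(q,d)$, independent of $(f_n)_{n\in\mathbb{N}}$ and $\lambda$, such that for every $\lambda>0$, the Lebesgue measure of the set $\{x\in\mathbb{R}^d : (\sum_{n=0}^{\infty}(Mf_n(x))^q)^{1/q}>\lambda\}$ is at most $(C/\lambda)\,\|\,(\sum_n |f_n|^q)^{1/q}\,\|_{L^1(\mathbb{R}^d)}$. -/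
open MeasureTheory ENNReal

/-- The Hardy-Littlewood maximal operator on `ℝ^d`:
`M f (x) = sup_{r > 0} (1/|B_r(x)|) ∫_{B_r(x)} |f(y)| dy`. -/
noncomputable def hlMax {d : ℕ} (f : EuclideanSpace ℝ (Fin d) → ℝ)
    (x : EuclideanSpace ℝ (Fin d)) : ℝ≥0∞ :=
  ⨆ (r : ℝ) (_ : 0 < r),
    (volume (Metric.ball x r))⁻¹ * ∫⁻ y in Metric.ball x r, ‖f y‖₊ ∂volume

section Maximal

open Metric

variable {E : Type*} [NormedAddCommGroup E] [MeasurableSpace E]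

/-- The centered maximal function of an `ℝ≥0∞`-valued function. -/
noncomputable def centeredMax (μ : Measure E) (u : E → ℝ≥0∞) (x : E) : ℝ≥0∞ :=
  ⨆ (r : ℝ) (_ : 0 < r), (μ (ball x r))⁻¹ * ∫⁻ y in ball x r, u y ∂μ

/-- The average of `u` over the ball around `y` whose radius is a quarter of the distance from `y`
to `F`. -/
noncomputable def whitneyAverage (μ : Measure E) (F : Set E) (u : E → ℝ≥0∞) (y : E) : ℝ≥0∞ :=
  (μ (ball y (infDist y F / 4)))⁻¹ * ∫⁻ z in ball y (infDist y F / 4), u z ∂μ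

theorem whitneyAverage_eq [BorelSpace E] {μ : Measure E} (F : Set E) (u : E → ℝ≥0∞) (y : E) :
    whitneyAverage μ F u y = (μ (ball y (infDist y F / 4)))⁻¹ *
      ∫⁻ z, (ball y (infDist y F / 4)).indicator u z ∂μ := by
  rw [whitneyAverage, lintegral_indicator measurableSet_ball]

variable [NormedSpace ℝ E] [FiniteDimensional ℝ E]
  {μ : Measure E} [μ.IsAddHaarMeasure] {u : E → ℝ≥0∞} {x : E} {t : ℝ≥0∞}

theorem lt_centeredMax_iff :
    t < centeredMax μ u x ↔ ∃ r, 0 < r ∧ t * μ (ball x r) < ∫⁻ y in ball x r, u y ∂μ := by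
  simp only [centeredMax, lt_iSup_iff, exists_prop]
  refine exists_congr fun r => and_congr_right fun hr => ?_
  rw [mul_comm, ← div_eq_mul_inv, ENNReal.lt_div_iff_mul_lt]
  · exact .inl (measure_ball_pos μ x hr).ne'
  · exact .inl measure_ball_lt_top.ne

theorem centeredMax_le_iff :
    centeredMax μ u x ≤ t ↔ ∀ r, 0 < r → ∫⁻ y in ball x r, u y ∂μ ≤ t * μ (ball x r) := by
  rw [← not_lt, lt_centeredMax_iff]
  push Not
  rfl

theorem setLIntegral_ball_le_centeredMax {r : ℝ} (hr : 0 < r) :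
    ∫⁻ y in ball x r, u y ∂μ ≤ centeredMax μ u x * μ (ball x r) :=
  centeredMax_le_iff.1 le_rfl r hr

theorem centeredMax_le_indicator_add (u : E → ℝ≥0∞) (s : ℝ≥0∞) (x : E) :
    centeredMax μ u x ≤ centeredMax μ ({y | s < u y}.indicator u) x + s := by
  rw [centeredMax_le_iff]
  intro r hr
  calc ∫⁻ y in ball x r, u y ∂μ ≤ ∫⁻ y in ball x r, ({y | s < u y}.indicator u y + s) ∂μ := by
        refine lintegral_mono fun y => ?_
        by_cases hy : s < u y
        · simp [Set.indicator_of_mem (show y ∈ {y | s < u y} from hy)]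
        · simpa [hy] using not_lt.1 hy
    _ = ∫⁻ y in ball x r, {y | s < u y}.indicator u y ∂μ + s * μ (ball x r) := by
        rw [lintegral_add_right _ measurable_const, setLIntegral_const]
    _ ≤ _ := by
        rw [add_mul]
        gcongr
        exact setLIntegral_ball_le_centeredMax hr

variable [BorelSpace E]

theorem measure_ball_mul (x y : E) {c : ℝ} (hc : 0 < c) (r : ℝ) :
    μ (ball x (c * r)) = ENNReal.ofReal (c ^ Module.finrank ℝ E) * μ (ball y r) := by
  rw [Measure.addHaar_ball_mul_of_pos μ x hc, Measure.addHaar_ball_center μ y]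

theorem isOpen_lt_centeredMax (μ : Measure E) [μ.IsAddHaarMeasure] (u : E → ℝ≥0∞) (t : ℝ≥0∞) :
    IsOpen {x | t < centeredMax μ u x} := by
  rw [Metric.isOpen_iff]
  intro x hx
  obtain ⟨r, hr, h⟩ := lt_centeredMax_iff.1 hx
  have hU : ball x r = ⋃ n : ℕ, ball x (r - 1 / ((n : ℝ) + 1)) := by
    ext y
    simp only [mem_ball, Set.mem_iUnion]
    constructor
    · intro hy
      obtain ⟨n, hn⟩ := exists_nat_one_div_lt (sub_pos.2 hy)
      exact ⟨n, by linarith⟩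
    · rintro ⟨n, hn⟩
      have : (0 : ℝ) < 1 / ((n : ℝ) + 1) := by positivity
      linarith
  have hmono : Monotone fun n : ℕ => ball x (r - 1 / ((n : ℝ) + 1)) := by
    intro m n hmn
    refine ball_subset_ball ?_
    have : 1 / ((n : ℝ) + 1) ≤ 1 / ((m : ℝ) + 1) := by gcongr
    linarith
  rw [hU, setLIntegral_iUnion_of_directed _ hmono.directed_le, ← hU, lt_iSup_iff] at h
  obtain ⟨n, hn⟩ := h
  refine ⟨1 / ((n : ℝ) + 1), by positivity, fun y hy => lt_centeredMax_iff.2 ⟨r, hr, ?_⟩⟩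
  rw [Measure.addHaar_ball_center, ← Measure.addHaar_ball_center μ x]
  refine hn.trans_le (lintegral_mono_set (ball_subset_ball' ?_))
  rw [mem_ball, dist_comm] at hy
  linarith

theorem measurable_centeredMax (μ : Measure E) [μ.IsAddHaarMeasure] (u : E → ℝ≥0∞) :
    Measurable (centeredMax μ u) :=
  measurable_of_Ioi fun t => (isOpen_lt_centeredMax μ u t).measurableSet

/-- The centered maximal operator is of weak type `(1, 1)`. -/
theorem mul_measure_lt_centeredMax_le (μ : Measure E) [μ.IsAddHaarMeasure] (u : E → ℝ≥0∞)
    (t : ℝ≥0∞) :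
    t * μ {x | t < centeredMax μ u x} ≤
      ENNReal.ofReal (5 ^ Module.finrank ℝ E) * ∫⁻ x, u x ∂μ := by
  set S : ℕ → Set E := fun n =>
    {x | ∃ r : ℝ, 0 < r ∧ r ≤ n ∧ t * μ (ball x r) < ∫⁻ y in ball x r, u y ∂μ}
  have hS : {x | t < centeredMax μ u x} = ⋃ n, S n := by
    ext x
    simp only [Set.mem_ofPred_eq, Set.mem_iUnion, lt_centeredMax_iff, S]
    constructor
    · rintro ⟨r, hr, h⟩
      obtain ⟨n, hn⟩ := exists_nat_ge r
      exact ⟨n, r, hr, hn, h⟩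
    · rintro ⟨n, r, hr, -, h⟩
      exact ⟨r, hr, h⟩
  have hmono : Monotone S := by
    rintro m n hmn x ⟨r, hr, hrm, h⟩
    exact ⟨r, hr, hrm.trans (by exact_mod_cast hmn), h⟩
  rw [hS, hmono.measure_iUnion, ENNReal.mul_iSup]
  refine iSup_le fun n => ?_
  have hex : ∀ x : E, ∃ r : ℝ, x ∈ S n →
      0 < r ∧ r ≤ n ∧ t * μ (ball x r) < ∫⁻ y in ball x r, u y ∂μ := fun x => by
    by_cases hx : x ∈ S n
    · exact hx.imp fun r hr _ => hr
    · exact ⟨0, fun h => absurd h hx⟩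
  choose r hr using hex
  obtain ⟨v, hvS, hvd, hv⟩ := Vitali.exists_disjoint_subfamily_covering_enlargement_closedBall
    (S n) id r n (fun a ha => (hr a ha).2.1) 5 (by norm_num)
  simp only [id] at hvd hv
  have hvd' : v.PairwiseDisjoint fun a => ball a (r a) :=
    hvd.mono fun a => ball_subset_closedBall
  have hvc : v.Countable := hvd'.countable_of_isOpen (fun _ _ => isOpen_ball)
    fun a ha => nonempty_ball.2 (hr a (hvS ha)).1
  have hcover : S n ⊆ ⋃ b ∈ v, closedBall b (5 * r b) := fun a ha => by
    obtain ⟨b, hb, hab⟩ := hv a ha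
    exact Set.mem_biUnion hb (hab (mem_closedBall_self (hr a ha).1.le))
  have hball : ∀ b ∈ v, t * μ (closedBall b (5 * r b)) ≤
      ENNReal.ofReal (5 ^ Module.finrank ℝ E) * ∫⁻ y in ball b (r b), u y ∂μ := fun b hb => by
    obtain ⟨h0, -, h⟩ := hr b (hvS hb)
    rw [Measure.addHaar_closedBall_mul_of_pos μ b (by norm_num), mul_left_comm]
    gcongr
    refine le_trans (le_of_eq ?_) h.le
    rw [Measure.addHaar_closedBall μ 0 h0.le, Measure.addHaar_ball_of_pos μ b h0]
  calc t * μ (S n) ≤ t * ∑' b : v, μ (closedBall (b : E) (5 * r b)) := by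
        gcongr
        exact (measure_mono hcover).trans (measure_biUnion_le μ hvc _)
    _ ≤ ENNReal.ofReal (5 ^ Module.finrank ℝ E) * ∑' b : v, ∫⁻ y in ball (b : E) (r b), u y ∂μ := by
        rw [← ENNReal.tsum_mul_left, ← ENNReal.tsum_mul_left]
        exact ENNReal.tsum_le_tsum fun b => hball b b.2
    _ ≤ ENNReal.ofReal (5 ^ Module.finrank ℝ E) * ∫⁻ x, u x ∂μ := by
        gcongr
        rw [← lintegral_biUnion hvc (fun _ _ => measurableSet_ball) hvd']
        exact setLIntegral_le_lintegral _ _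

/-- Almost everywhere, a function is controlled by its centered maximal function. -/
theorem ae_le_centeredMax (hu : Measurable u) (hfin : ∫⁻ x, u x ∂μ ≠ ⊤) :
    ∀ᵐ x ∂μ, u x ≤ ENNReal.ofReal (2 ^ Module.finrank ℝ E) * centeredMax μ u x := by
  filter_upwards [(Besicovitch.vitaliFamily μ).ae_tendsto_lintegral_div hu.aemeasurable hfin]
    with x hx
  refine le_of_tendsto (hx.comp (Besicovitch.tendsto_filterAt μ x)) ?_
  filter_upwards [self_mem_nhdsWithin] with r hr
  have hr : 0 < r := hr
  refine ENNReal.div_le_of_le_mul ?_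
  calc ∫⁻ y in closedBall x r, u y ∂μ ≤ ∫⁻ y in ball x (2 * r), u y ∂μ :=
        lintegral_mono_set (closedBall_subset_ball (by linarith))
    _ ≤ centeredMax μ u x * μ (ball x (2 * r)) :=
        setLIntegral_ball_le_centeredMax (by positivity)
    _ ≤ ENNReal.ofReal (2 ^ Module.finrank ℝ E) * centeredMax μ u x * μ (closedBall x r) := by
        rw [measure_ball_mul x x two_pos, ← mul_assoc, mul_comm (centeredMax μ u x)]
        gcongr
        exact ball_subset_closedBall

theorem mul_measure_two_mul_lt_centeredMax_le (hu : Measurable u) {s : ℝ≥0∞} (hs : s ≠ ⊤) :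
    s * μ {x | 2 * s < centeredMax μ u x} ≤
      ENNReal.ofReal (5 ^ Module.finrank ℝ E) * ∫⁻ x in {x | s < u x}, u x ∂μ := by
  rw [← lintegral_indicator (measurableSet_lt measurable_const hu)]
  refine le_trans ?_ (mul_measure_lt_centeredMax_le μ _ s)
  gcongr s * μ ?_
  intro x hx
  have h := lt_of_lt_of_le hx (centeredMax_le_indicator_add (μ := μ) u s x)
  rw [two_mul] at h
  exact (ENNReal.add_lt_add_iff_right hs).1 h

theorem rpow_eq_lintegral_of_ne_top {p : ℝ} (hp : 0 < p) {a : ℝ≥0∞} (ha : a ≠ ⊤) :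
    a ^ p = ENNReal.ofReal p * ∫⁻ t in Set.Ioi (0 : ℝ),
      if ENNReal.ofReal t < a then ENNReal.ofReal (t ^ (p - 1)) else 0 := by
  have h := lintegral_rpow_eq_lintegral_meas_lt_mul (Measure.dirac ()) (f := fun _ => a.toReal)
    (.of_forall fun _ => ENNReal.toReal_nonneg) aemeasurable_const hp
  simp only [lintegral_dirac] at h
  rw [← ENNReal.ofReal_rpow_of_nonneg ENNReal.toReal_nonneg hp.le, ENNReal.ofReal_toReal ha] at h
  rw [h]
  congr 1
  refine setLIntegral_congr_fun measurableSet_Ioi fun t ht => ?_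
  have ht : 0 < t := ht
  have : ENNReal.ofReal t < a ↔ t < a.toReal := ENNReal.ofReal_lt_iff_lt_toReal ht.le ha
  by_cases hta : t < a.toReal <;> simp [this, hta]

theorem rpow_eq_lintegral {p : ℝ} (hp : 0 < p) (a : ℝ≥0∞) :
    a ^ p = ENNReal.ofReal p * ∫⁻ t in Set.Ioi (0 : ℝ),
      if ENNReal.ofReal t < a then ENNReal.ofReal (t ^ (p - 1)) else 0 := by
  rcases eq_or_ne a ⊤ with rfl | ha
  · rw [ENNReal.top_rpow_of_pos hp, eq_comm, eq_top_iff]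
    refine ENNReal.le_of_forall_nnreal_lt fun b _ => ?_
    rw [show (b : ℝ≥0∞) = ((b : ℝ≥0∞) ^ p⁻¹) ^ p by
      rw [← ENNReal.rpow_mul, inv_mul_cancel₀ hp.ne', ENNReal.rpow_one],
      rpow_eq_lintegral_of_ne_top hp (by simp [hp.le] : (b : ℝ≥0∞) ^ p⁻¹ ≠ ⊤)]
    gcongr with t
    split_ifs <;> simp_all
  · exact rpow_eq_lintegral_of_ne_top hp ha

/-- The centered maximal operator is of strong type `(q, q)` for `1 < q < ∞`. -/
theorem lintegral_centeredMax_rpow_le (μ : Measure E) [μ.IsAddHaarMeasure] {q : ℝ} (hq : 1 < q) :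
    ∃ A : ℝ≥0∞, A ≠ ⊤ ∧ ∀ u : E → ℝ≥0∞, Measurable u →
      ∫⁻ x, centeredMax μ u x ^ q ∂μ ≤ A * ∫⁻ x, u x ^ q ∂μ := by
  set B := ENNReal.ofReal (5 ^ Module.finrank ℝ E)
  refine ⟨ENNReal.ofReal q * (2 * B * ((ENNReal.ofReal (q - 1))⁻¹ * 2 ^ (q - 1))), ?_,
    fun u hu => ?_⟩
  · have : ENNReal.ofReal (q - 1) ≠ 0 := by simpa using hq
    finiteness
  have hq1 : 0 < q - 1 := by linarith
  have hM := measurable_centeredMax μ u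
  have hlevel : ∀ t : ℝ, 0 < t → μ {x | ENNReal.ofReal t < centeredMax μ u x} *
      ENNReal.ofReal (t ^ (q - 1)) ≤
      2 * B * ∫⁻ x, if ENNReal.ofReal t < 2 * u x then
        ENNReal.ofReal (t ^ (q - 1 - 1)) * u x else 0 ∂μ := fun t ht => by
    have h := mul_measure_two_mul_lt_centeredMax_le (μ := μ) hu
      (s := ENNReal.ofReal (t / 2)) ENNReal.ofReal_ne_top
    have h2 : 2 * ENNReal.ofReal (t / 2) = ENNReal.ofReal t := by
      rw [← ENNReal.ofReal_ofNat, ← ENNReal.ofReal_mul (by norm_num)]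
      congr 1; ring
    have h3 : {x | ENNReal.ofReal (t / 2) < u x} = {x | ENNReal.ofReal t < 2 * u x} := by
      ext x
      simp only [Set.mem_ofPred_eq, ← h2]
      exact (ENNReal.mul_lt_mul_iff_right (by norm_num) (by norm_num)).symm
    rw [h2, h3, ← lintegral_indicator (measurableSet_lt measurable_const (hu.const_mul 2))] at h
    have h4 : ENNReal.ofReal (t ^ (q - 1)) =
        2 * ENNReal.ofReal (t ^ (q - 1 - 1)) * ENNReal.ofReal (t / 2) := by
      rw [mul_right_comm, h2, ← ENNReal.ofReal_mul ht.le, ← Real.rpow_one_add' ht.le (by linarith)]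
      congr 2; ring
    calc _ = 2 * ENNReal.ofReal (t ^ (q - 1 - 1)) *
          (ENNReal.ofReal (t / 2) * μ {x | ENNReal.ofReal t < centeredMax μ u x}) := by
          rw [h4]; ring
      _ ≤ 2 * ENNReal.ofReal (t ^ (q - 1 - 1)) * (B *
          ∫⁻ x, {x | ENNReal.ofReal t < 2 * u x}.indicator u x ∂μ) := by gcongr
      _ = 2 * B * (ENNReal.ofReal (t ^ (q - 1 - 1)) *
          ∫⁻ x, {x | ENNReal.ofReal t < 2 * u x}.indicator u x ∂μ) := by ring
      _ = _ := by
          rw [← lintegral_const_mul' _ _ ENNReal.ofReal_ne_top]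
          simp only [Set.indicator_apply, Set.mem_ofPred_eq, mul_ite, mul_zero]
  have hm : ∀ (w : E → ℝ≥0∞) (v : E → ℝ≥0∞) (e : ℝ), Measurable w → Measurable v →
      Measurable fun p : E × ℝ =>
        if ENNReal.ofReal p.2 < w p.1 then ENNReal.ofReal (p.2 ^ e) * v p.1 else 0 :=
    fun w v e hw hv => Measurable.ite (measurableSet_lt (by fun_prop) (by fun_prop))
      (by fun_prop) measurable_const
  calc ∫⁻ x, centeredMax μ u x ^ q ∂μ
      = ENNReal.ofReal q * ∫⁻ x, (∫⁻ t in Set.Ioi (0 : ℝ),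
          if ENNReal.ofReal t < centeredMax μ u x then ENNReal.ofReal (t ^ (q - 1)) else 0) ∂μ := by
        rw [← lintegral_const_mul' _ _ ENNReal.ofReal_ne_top]
        exact lintegral_congr fun x => rpow_eq_lintegral (by linarith) _
    _ = ENNReal.ofReal q * ∫⁻ t in Set.Ioi (0 : ℝ), μ {x | ENNReal.ofReal t < centeredMax μ u x} *
          ENNReal.ofReal (t ^ (q - 1)) := by
        rw [lintegral_lintegral_swap]
        · congr 1
          refine lintegral_congr fun t => ?_
          rw [mul_comm, ← lintegral_indicator_const (measurableSet_lt measurable_const hM)]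
          simp only [Set.indicator_apply, Set.mem_ofPred_eq]
        · have h := hm _ (fun _ => 1) (q - 1) hM measurable_const
          simp only [mul_one] at h
          exact h.aemeasurable
    _ ≤ ENNReal.ofReal q * ∫⁻ t in Set.Ioi (0 : ℝ), 2 * B *
          ∫⁻ x, if ENNReal.ofReal t < 2 * u x then
            ENNReal.ofReal (t ^ (q - 1 - 1)) * u x else 0 ∂μ := by
        gcongr ENNReal.ofReal q * ?_
        exact setLIntegral_mono' measurableSet_Ioi hlevel
    _ = ENNReal.ofReal q * (2 * B * ∫⁻ x, (u x * ∫⁻ t in Set.Ioi (0 : ℝ),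
          if ENNReal.ofReal t < 2 * u x then ENNReal.ofReal (t ^ (q - 1 - 1)) else 0) ∂μ) := by
        rw [lintegral_const_mul' _ _ (by finiteness), ← lintegral_lintegral_swap]
        · congr 2
          refine lintegral_congr fun x => ?_
          rw [← lintegral_const_mul]
          · simp only [mul_ite, mul_zero, mul_comm]
          · exact Measurable.ite (measurableSet_lt (by fun_prop) (by fun_prop))
              (by fun_prop) measurable_const
        · exact (hm _ _ _ (hu.const_mul 2) hu).aemeasurable
    _ = ENNReal.ofReal q * (2 * B * ∫⁻ x, ((ENNReal.ofReal (q - 1))⁻¹ * 2 ^ (q - 1)) *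
          u x ^ q ∂μ) := by
        congr 2
        refine lintegral_congr fun x => ?_
        have h0 : ENNReal.ofReal (q - 1) ≠ 0 := by simpa using hq
        have h := rpow_eq_lintegral hq1 (2 * u x)
        rw [ENNReal.mul_rpow_of_nonneg _ _ hq1.le] at h
        have hx : u x ^ q = u x * u x ^ (q - 1) := by
          conv_rhs => enter [1]; rw [← ENNReal.rpow_one (u x)]
          rw [← ENNReal.rpow_add_of_nonneg _ _ zero_le_one hq1.le]
          congr 1; ring
        rw [hx, mul_assoc, mul_left_comm (2 ^ (q - 1)), h, mul_left_comm (_)⁻¹, ← mul_assoc _⁻¹,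
          ENNReal.inv_mul_cancel h0 ENNReal.ofReal_ne_top, one_mul]
    _ = _ := by
        rw [lintegral_const_mul _ (by fun_prop)]
        ring

theorem measurableSet_whitneyBalls (F : Set E) :
    MeasurableSet {p : E × E | p.2 ∈ ball p.1 (infDist p.1 F / 4)} := by
  refine (isOpen_lt (f := fun p : E × E => dist p.2 p.1)
    (g := fun p : E × E => infDist p.1 F / 4) (by fun_prop) ?_).measurableSet
  exact ((continuous_infDist_pt F).comp continuous_fst).div_const 4

theorem measurable_measure_whitneyBall (μ : Measure E) [μ.IsAddHaarMeasure] (F : Set E) :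
    Measurable fun y => μ (ball y (infDist y F / 4)) :=
  measurable_measure_prodMk_left (ν := μ) (measurableSet_whitneyBalls F)

theorem measurable_uncurry_whitneyBall_indicator (F : Set E) (hu : Measurable u) :
    Measurable fun p : E × E => (ball p.1 (infDist p.1 F / 4)).indicator u p.2 := by
  have h := (hu.comp measurable_snd).indicator (measurableSet_whitneyBalls F)
  exact h

theorem measurable_whitneyAverage (F : Set E) (hu : Measurable u) :
    Measurable (whitneyAverage μ F u) := by
  simp_rw [funext (whitneyAverage_eq F u)]
  exact (measurable_measure_whitneyBall μ F).inv.mul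
    (measurable_uncurry_whitneyBall_indicator F hu).lintegral_prod_right'

/-- Whitney averages are controlled by the maximal function on the reference set. -/
theorem whitneyAverage_le {F : Set E} (hF : F.Nonempty) {y : E} (hy : 0 < infDist y F)
    (h : ∀ z ∈ F, centeredMax μ u z ≤ t) :
    whitneyAverage μ F u y ≤ ENNReal.ofReal (9 ^ Module.finrank ℝ E) * t := by
  obtain ⟨z, hz, hyz⟩ := (infDist_lt_iff hF).1 (show infDist y F < 2 * infDist y F by linarith)
  set δ := infDist y F
  have hpos : 0 < δ / 4 := by positivity
  rw [whitneyAverage, mul_comm, ← div_eq_mul_inv]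
  refine ENNReal.div_le_of_le_mul ?_
  calc ∫⁻ x in ball y (δ / 4), u x ∂μ ≤ ∫⁻ x in ball z (9 * (δ / 4)), u x ∂μ :=
        lintegral_mono_set (ball_subset_ball' (by linarith))
    _ ≤ t * μ (ball z (9 * (δ / 4))) := centeredMax_le_iff.1 (h z hz) _ (by positivity)
    _ = _ := by rw [measure_ball_mul z y (by norm_num)]; ring

/-- Passing to Whitney averages loses at most a constant in integrals over balls centered on the
reference set. -/
theorem setLIntegral_ball_diff_le_whitneyAverage {F : Set E} (hF : IsClosed F) (hu : Measurable u)
    (hx : x ∈ F) (r : ℝ) :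
    ∫⁻ z in ball x r \ F, u z ∂μ ≤ ENNReal.ofReal (2 ^ Module.finrank ℝ E) *
      ∫⁻ y in ball x (2 * r) \ F, whitneyAverage μ F u y ∂μ := by
  set K := ENNReal.ofReal (2 ^ Module.finrank ℝ E)
  set δ : E → ℝ := fun y => infDist y F
  set w : E → ℝ≥0∞ := fun y => (μ (ball y (δ y / 4)))⁻¹
  have hw : Measurable w := (measurable_measure_whitneyBall μ F).inv
  have hk := measurable_uncurry_whitneyBall_indicator F hu
  have key : ∀ z ∈ ball x r \ F,
      1 ≤ K * ∫⁻ y in ball x (2 * r) \ F, (ball y (δ y / 4)).indicator (fun _ => w y) z ∂μ := by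
    rintro z ⟨hzx, hzF⟩
    have hδ : 0 < δ z := (hF.notMem_iff_infDist_pos ⟨x, hx⟩).1 hzF
    have hδr : δ z < r := (infDist_le_dist_of_mem hx).trans_lt hzx
    set m := μ (ball z (δ z / 5))
    have hm0 : m ≠ 0 := (measure_ball_pos μ z (by positivity)).ne'
    have hmt : m ≠ ⊤ := measure_ball_lt_top.ne
    have hsub : ball z (δ z / 5) ⊆ ball x (2 * r) \ F := fun y hy => by
      refine ⟨ball_subset_ball' ?_ hy, fun hyF => ?_⟩
      · have : dist z x < r := hzx
        linarith
      · have := infDist_le_dist_of_mem hyF (x := z)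
        rw [mem_ball, dist_comm] at hy
        change δ z ≤ _ at this
        linarith
    have hpt : ∀ y ∈ ball z (δ z / 5),
        K⁻¹ * m⁻¹ ≤ (ball y (δ y / 4)).indicator (fun _ => w y) z := fun y hy => by
      rw [mem_ball] at hy
      have h1 : δ z ≤ δ y + dist z y := infDist_le_infDist_add_dist
      have h2 : δ y ≤ δ z + dist y z := infDist_le_infDist_add_dist
      have h3 := dist_comm y z
      have hzy : z ∈ ball y (δ y / 4) := by
        rw [mem_ball]; linarith
      rw [Set.indicator_of_mem hzy, ← ENNReal.mul_inv (.inr hmt) (.inr hm0)]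
      refine ENNReal.inv_le_inv.2 ?_
      rw [← measure_ball_mul y z two_pos]
      exact measure_mono (ball_subset_ball (by linarith))
    have hK0 : K ≠ 0 := by simp [K]
    calc (1 : ℝ≥0∞) = K * (K⁻¹ * m⁻¹ * m) := by
          rw [mul_assoc, ENNReal.inv_mul_cancel hm0 hmt, mul_one,
            ENNReal.mul_inv_cancel hK0 ENNReal.ofReal_ne_top]
      _ = K * ∫⁻ y in ball z (δ z / 5), K⁻¹ * m⁻¹ ∂μ := by rw [setLIntegral_const]
      _ ≤ K * ∫⁻ y in ball z (δ z / 5), (ball y (δ y / 4)).indicator (fun _ => w y) z ∂μ := by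
          gcongr K * ?_
          exact setLIntegral_mono' measurableSet_ball hpt
      _ ≤ _ := by
          gcongr K * ?_
          exact lintegral_mono_set hsub
  have hmeas : Measurable fun p : E × E => w p.1 * (ball p.1 (δ p.1 / 4)).indicator u p.2 :=
    (hw.comp measurable_fst).mul hk
  have hflip : ∀ y z, w y * (ball y (δ y / 4)).indicator u z =
      u z * (ball y (δ y / 4)).indicator (fun _ => w y) z := fun y z => by
    by_cases hz : z ∈ ball y (δ y / 4) <;> simp [hz, mul_comm]
  have hmeas1 : ∀ z, Measurable fun y => (ball y (δ y / 4)).indicator (fun _ => w y) z := fun z => by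
    have := (hw.comp measurable_fst).indicator (measurableSet_whitneyBalls F)
    exact this.comp measurable_prodMk_right
  calc ∫⁻ z in ball x r \ F, u z ∂μ
      ≤ ∫⁻ z in ball x r \ F, u z * (K * ∫⁻ y in ball x (2 * r) \ F,
          (ball y (δ y / 4)).indicator (fun _ => w y) z ∂μ) ∂μ :=
        setLIntegral_mono' (measurableSet_ball.diff hF.measurableSet) fun z hz =>
          le_mul_of_one_le_right' (key z hz)
    _ ≤ ∫⁻ z, u z * (K * ∫⁻ y in ball x (2 * r) \ F,
          (ball y (δ y / 4)).indicator (fun _ => w y) z ∂μ) ∂μ := setLIntegral_le_lintegral _ _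
    _ = K * ∫⁻ z, ∫⁻ y in ball x (2 * r) \ F, w y * (ball y (δ y / 4)).indicator u z ∂μ ∂μ := by
        rw [← lintegral_const_mul' _ _ ENNReal.ofReal_ne_top]
        refine lintegral_congr fun z => ?_
        simp only [hflip]
        rw [lintegral_const_mul _ (hmeas1 z), mul_left_comm]
    _ = K * ∫⁻ y in ball x (2 * r) \ F, ∫⁻ z, w y * (ball y (δ y / 4)).indicator u z ∂μ ∂μ := by
        rw [lintegral_lintegral_swap]
        exact (hmeas.comp measurable_swap).aemeasurable
    _ = _ := by
        congr 1
        refine lintegral_congr fun y => ?_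
        rw [whitneyAverage_eq, lintegral_const_mul _ (hu.indicator measurableSet_ball)]

end Maximal

section Minkowski

variable {α ι : Type*} [MeasurableSpace α] {ν : Measure α} {q : ℝ} {φ : ι → α → ℝ≥0∞}

theorem ENNReal.sum_lintegral_rpow_le (hq : 1 < q) (hφ : ∀ i, Measurable (φ i)) (s : Finset ι) :
    ∑ i ∈ s, (∫⁻ x, φ i x ∂ν) ^ q ≤ (∫⁻ x, (∑ i ∈ s, φ i x ^ q) ^ (1 / q) ∂ν) ^ q := by
  have hq0 : 0 < q := by linarith
  set J := ∫⁻ x, (∑ i ∈ s, φ i x ^ q) ^ (1 / q) ∂ν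
  set S := ∑ i ∈ s, (∫⁻ x, φ i x ∂ν) ^ q with hS
  rcases eq_or_ne J ⊤ with hJ | hJ
  · simp [hJ, hq0]
  have hle : ∀ i ∈ s, ∫⁻ x, φ i x ∂ν ≤ J := fun i hi => by
    refine lintegral_mono fun x => ?_
    rw [one_div, ENNReal.le_rpow_inv_iff hq0]
    exact Finset.single_le_sum (f := fun i => φ i x ^ q) (fun _ _ => zero_le) hi
  have hSt : S ≠ ⊤ := ENNReal.sum_ne_top.2 fun i hi =>
    ENNReal.rpow_ne_top_of_nonneg hq0.le ((hle i hi).trans_lt hJ.lt_top).ne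
  rcases eq_or_ne S 0 with hS0 | hS0
  · simp [hS0]
  have hpq : (q / (q - 1)).HolderConjugate q := (Real.HolderConjugate.conjExponent hq).symm
  have hholder : S ≤ S ^ (1 / (q / (q - 1))) * J := by
    calc S = ∑ i ∈ s, (∫⁻ x, φ i x ∂ν) ^ (q - 1) * ∫⁻ x, φ i x ∂ν := by
          refine Finset.sum_congr rfl fun i _ => ?_
          conv_rhs => enter [2]; rw [← ENNReal.rpow_one (∫⁻ x, φ i x ∂ν)]
          rw [← ENNReal.rpow_add_of_nonneg _ _ (by linarith) zero_le_one, sub_add_cancel]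
      _ = ∫⁻ x, ∑ i ∈ s, (∫⁻ x, φ i x ∂ν) ^ (q - 1) * φ i x ∂ν := by
          rw [lintegral_finsetSum _ fun i _ => (hφ i).const_mul _]
          exact Finset.sum_congr rfl fun i _ => (lintegral_const_mul _ (hφ i)).symm
      _ ≤ ∫⁻ x, S ^ (1 / (q / (q - 1))) * (∑ i ∈ s, φ i x ^ q) ^ (1 / q) ∂ν := by
          refine lintegral_mono fun x => (ENNReal.inner_le_Lp_mul_Lq s _ _ hpq).trans_eq ?_
          have : (q - 1) * (q / (q - 1)) = q := mul_div_cancel₀ _ (by linarith)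
          simp only [← ENNReal.rpow_mul, this, hS]
      _ = _ := lintegral_const_mul' _ _ (ENNReal.rpow_ne_top_of_nonneg (by
          have := hpq.pos; positivity) hSt)
  rw [← ENNReal.rpow_inv_le_iff hq0]
  have hc0 : S ^ (1 / (q / (q - 1))) ≠ 0 := by simp [ENNReal.rpow_eq_zero_iff, hS0, hSt]
  have hct : S ^ (1 / (q / (q - 1))) ≠ ⊤ :=
    ENNReal.rpow_ne_top_of_nonneg (by have := hpq.pos; positivity) hSt
  refine (ENNReal.mul_le_mul_iff_right hc0 hct).1 (le_trans (le_of_eq ?_) hholder)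
  rw [← ENNReal.rpow_add _ _ hS0 hSt, one_div, hpq.inv_add_inv_eq_one, ENNReal.rpow_one]

/-- Minkowski's integral inequality for `ℓ^q`-valued functions. -/
theorem ENNReal.tsum_lintegral_rpow_le (hq : 1 < q) (hφ : ∀ i, Measurable (φ i)) :
    ∑' i, (∫⁻ x, φ i x ∂ν) ^ q ≤ (∫⁻ x, (∑' i, φ i x ^ q) ^ (1 / q) ∂ν) ^ q := by
  rw [ENNReal.tsum_eq_iSup_sum]
  refine iSup_le fun s => (ENNReal.sum_lintegral_rpow_le hq hφ s).trans ?_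
  gcongr with x
  exact ENNReal.sum_le_tsum s

end Minkowski

section FeffermanStein

open Metric

variable {E : Type*} [NormedAddCommGroup E] [MeasurableSpace E] {μ : Measure E}

/-- Taking Whitney averages of an `ℓ^q`-valued function does not increase its norm beyond the
Whitney average of the norm. -/
theorem tsum_whitneyAverage_rpow_le {q : ℝ} (hq : 1 < q) {φ : ℕ → E → ℝ≥0∞}
    (hφ : ∀ n, Measurable (φ n)) (F : Set E) (y : E) :
    ∑' n, whitneyAverage μ F (φ n) y ^ q ≤
      whitneyAverage μ F (fun x => (∑' n, φ n x ^ q) ^ (1 / q)) y ^ q := by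
  have hq0 : 0 ≤ q := by linarith
  simp only [whitneyAverage, ENNReal.mul_rpow_of_nonneg _ _ hq0]
  rw [ENNReal.tsum_mul_left]
  gcongr
  exact ENNReal.tsum_lintegral_rpow_le hq hφ

variable [NormedSpace ℝ E] [FiniteDimensional ℝ E] [BorelSpace E] [μ.IsAddHaarMeasure]

/-- Replacing `u` by its Whitney averages off a closed set `F` does not decrease, up to a constant,
the maximal function on `F`. -/
theorem centeredMax_le_piecewise_whitneyAverage {F : Set E} [DecidablePred (· ∈ F)]
    (hF : IsClosed F) {u : E → ℝ≥0∞} (hu : Measurable u) {x : E} (hx : x ∈ F) :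
    centeredMax μ u x ≤ ENNReal.ofReal (2 ^ Module.finrank ℝ E) ^ 2 *
      centeredMax μ (F.piecewise u (whitneyAverage μ F u)) x := by
  set K := ENNReal.ofReal (2 ^ Module.finrank ℝ E) with hK
  set g := F.piecewise u (whitneyAverage μ F u)
  have hK1 : 1 ≤ K := by
    rw [hK, ENNReal.one_le_ofReal]
    exact one_le_pow₀ one_le_two
  rw [centeredMax_le_iff]
  intro r hr
  have h1 : ∫⁻ y in ball x r ∩ F, u y ∂μ ≤ K * ∫⁻ y in ball x (2 * r) ∩ F, g y ∂μ := by
    rw [← setLIntegral_congr_fun (f := g) (g := u) (measurableSet_ball.inter hF.measurableSet)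
      fun y hy => Set.piecewise_eq_of_mem _ _ _ hy.2]
    exact (lintegral_mono_set (Set.inter_subset_inter_left _ (ball_subset_ball (by linarith)))).trans
      (le_mul_of_one_le_left' hK1)
  have h2 : ∫⁻ y in ball x r \ F, u y ∂μ ≤ K * ∫⁻ y in ball x (2 * r) \ F, g y ∂μ := by
    rw [setLIntegral_congr_fun (f := g) (g := whitneyAverage μ F u)
      (measurableSet_ball.diff hF.measurableSet) fun y hy => Set.piecewise_eq_of_notMem _ _ _ hy.2]
    exact setLIntegral_ball_diff_le_whitneyAverage hF hu hx r
  calc ∫⁻ y in ball x r, u y ∂μ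
      = ∫⁻ y in ball x r ∩ F, u y ∂μ + ∫⁻ y in ball x r \ F, u y ∂μ :=
        (lintegral_inter_add_sdiff _ _ hF.measurableSet).symm
    _ ≤ K * ∫⁻ y in ball x (2 * r), g y ∂μ := by
        rw [← lintegral_inter_add_sdiff g (ball x (2 * r)) hF.measurableSet, mul_add]
        exact add_le_add h1 h2
    _ ≤ K * (centeredMax μ g x * (K * μ (ball x r))) := by
        rw [← measure_ball_mul x x two_pos]
        gcongr
        exact setLIntegral_ball_le_centeredMax (by positivity)
    _ = _ := by ring

/-- The Fefferman-Stein weak type `(1, 1)` inequality for the centered maximal operator. -/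
theorem exists_mul_measure_lt_tsum_centeredMax_le (μ : Measure E) [μ.IsAddHaarMeasure] {q : ℝ}
    (hq : 1 < q) :
    ∃ K : ℝ≥0∞, K ≠ ⊤ ∧ ∀ φ : ℕ → E → ℝ≥0∞, (∀ n, Measurable (φ n)) →
      ∫⁻ x, (∑' n, φ n x ^ q) ^ (1 / q) ∂μ ≠ ⊤ → ∀ l : ℝ≥0∞, l ≠ 0 → l ≠ ⊤ →
        l * μ {x | l < (∑' n, centeredMax μ (φ n) x ^ q) ^ (1 / q)} ≤
          K * ∫⁻ x, (∑' n, φ n x ^ q) ^ (1 / q) ∂μ := by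
  classical
  have hq0 : 0 < q := by linarith
  have hq1 : 0 < q - 1 := by linarith
  obtain ⟨A, hA, hstrong⟩ := lintegral_centeredMax_rpow_le μ hq
  set c₂ := ENNReal.ofReal (2 ^ Module.finrank ℝ E)
  set c₅ := ENNReal.ofReal (5 ^ Module.finrank ℝ E)
  set c₉ := ENNReal.ofReal (9 ^ Module.finrank ℝ E)
  refine ⟨c₅ + (c₂ ^ 2) ^ q * (A * (c₂ ^ (q - 1) + c₉ ^ q * c₅)), by finiteness,
    fun φ hφ hfin l hl0 hlt => ?_⟩
  set f : E → ℝ≥0∞ := fun x => (∑' n, φ n x ^ q) ^ (1 / q) with hf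
  have hfm : Measurable f := by fun_prop
  set I := ∫⁻ x, f x ∂μ
  set F : Set E := {x | l < centeredMax μ f x}ᶜ with hFdef
  have hF : IsClosed F := (isOpen_lt_centeredMax μ f l).isClosed_compl
  have hweak : l * μ Fᶜ ≤ c₅ * I := by
    rw [hFdef, compl_compl]
    exact mul_measure_lt_centeredMax_le μ f l
  have hFle : ∀ z ∈ F, centeredMax μ f z ≤ l := fun z hz => not_lt.1 hz
  rcases F.eq_empty_or_nonempty with hFe | hFne
  · rw [add_mul]
    refine le_trans ?_ (hweak.trans le_self_add)
    gcongr
    simp [hFe]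
  set g : ℕ → E → ℝ≥0∞ := fun n => F.piecewise (φ n) (whitneyAverage μ F (φ n))
  have hg : ∀ n, Measurable (g n) := fun n =>
    (hφ n).piecewise hF.measurableSet (measurable_whitneyAverage F (hφ n))
  have hlq : l ^ q = l ^ (q - 1) * l := by
    conv_rhs => enter [2]; rw [← ENNReal.rpow_one l]
    rw [← ENNReal.rpow_add_of_nonneg _ _ hq1.le zero_le_one, sub_add_cancel]
  have hgF : ∫⁻ x in F, ∑' n, g n x ^ q ∂μ ≤ c₂ ^ (q - 1) * l ^ (q - 1) * I := by
    calc ∫⁻ x in F, ∑' n, g n x ^ q ∂μ ≤ ∫⁻ x in F, (c₂ ^ (q - 1) * l ^ (q - 1)) * f x ∂μ := by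
          refine setLIntegral_mono_ae' hF.measurableSet ?_
          filter_upwards [ae_le_centeredMax hfm hfin] with x hx hxF
          have hfx : f x ≤ c₂ * l := hx.trans (by gcongr; exact hFle x hxF)
          simp only [g, Set.piecewise_eq_of_mem _ _ _ hxF]
          calc ∑' n, φ n x ^ q = f x ^ q := by
                simp only [hf, one_div]
                rw [ENNReal.rpow_inv_rpow hq0.ne']
            _ = f x ^ (q - 1) * f x := by
                conv_rhs => enter [2]; rw [← ENNReal.rpow_one (f x)]
                rw [← ENNReal.rpow_add_of_nonneg _ _ hq1.le zero_le_one, sub_add_cancel]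
            _ ≤ (c₂ * l) ^ (q - 1) * f x := by gcongr
            _ = _ := by rw [ENNReal.mul_rpow_of_nonneg _ _ hq1.le]
      _ ≤ ∫⁻ x, (c₂ ^ (q - 1) * l ^ (q - 1)) * f x ∂μ := setLIntegral_le_lintegral _ _
      _ = _ := lintegral_const_mul _ hfm
  have hgFc : ∫⁻ x in Fᶜ, ∑' n, g n x ^ q ∂μ ≤ c₉ ^ q * l ^ (q - 1) * (c₅ * I) := by
    calc ∫⁻ x in Fᶜ, ∑' n, g n x ^ q ∂μ ≤ ∫⁻ x in Fᶜ, (c₉ * l) ^ q ∂μ := by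
          refine setLIntegral_mono' hF.measurableSet.compl fun x hx => ?_
          simp only [g, Set.piecewise_eq_of_notMem _ _ _ hx]
          refine (tsum_whitneyAverage_rpow_le hq hφ F x).trans ?_
          gcongr
          exact whitneyAverage_le hFne ((hF.notMem_iff_infDist_pos hFne).1 hx) hFle
      _ = c₉ ^ q * l ^ (q - 1) * (l * μ Fᶜ) := by
          rw [setLIntegral_const, ENNReal.mul_rpow_of_nonneg _ _ hq0.le, hlq]
          ring
      _ ≤ _ := by gcongr
  have hG : ∫⁻ x, ∑' n, g n x ^ q ∂μ ≤ l ^ (q - 1) * ((c₂ ^ (q - 1) + c₉ ^ q * c₅) * I) := by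
    rw [← lintegral_add_compl _ hF.measurableSet]
    exact (add_le_add hgF hgFc).trans_eq (by ring)
  have hMg : ∫⁻ x, ∑' n, centeredMax μ (g n) x ^ q ∂μ ≤ A * ∫⁻ x, ∑' n, g n x ^ q ∂μ := by
    rw [lintegral_tsum fun n => ((hg n).pow_const q).aemeasurable,
      lintegral_tsum fun n => ((measurable_centeredMax μ (g n)).pow_const q).aemeasurable,
      ← ENNReal.tsum_mul_left]
    exact ENNReal.tsum_le_tsum fun n => hstrong _ (hg n)
  have hMgm : Measurable fun x => (c₂ ^ 2) ^ q * ∑' n, centeredMax μ (g n) x ^ q :=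
    (Measurable.tsum fun n => (measurable_centeredMax μ (g n)).pow_const q).const_mul _
  set T := {x | l ^ q ≤ (c₂ ^ 2) ^ q * ∑' n, centeredMax μ (g n) x ^ q}
  have hsub : {x | l < (∑' n, centeredMax μ (φ n) x ^ q) ^ (1 / q)} ⊆ Fᶜ ∪ T := by
    intro x hx
    by_cases hxF : x ∈ F
    · refine .inr ?_
      rw [Set.mem_ofPred_eq, one_div, ENNReal.lt_rpow_inv_iff hq0] at hx
      refine hx.le.trans ?_
      rw [← ENNReal.tsum_mul_left]
      refine ENNReal.tsum_le_tsum fun n => ?_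
      rw [← ENNReal.mul_rpow_of_nonneg _ _ hq0.le]
      gcongr
      exact centeredMax_le_piecewise_whitneyAverage hF (hφ n) hxF
    · exact .inl hxF
  have hT : l * μ T ≤ (c₂ ^ 2) ^ q * (A * ((c₂ ^ (q - 1) + c₉ ^ q * c₅) * I)) := by
    have hp0 : l ^ (q - 1) ≠ 0 := by simp [ENNReal.rpow_eq_zero_iff, hl0, hlt]
    have hpt : l ^ (q - 1) ≠ ⊤ := ENNReal.rpow_ne_top_of_nonneg hq1.le hlt
    refine (ENNReal.mul_le_mul_iff_right hp0 hpt).1 ?_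
    calc l ^ (q - 1) * (l * μ T) = l ^ q * μ T := by rw [hlq, mul_assoc]
      _ ≤ ∫⁻ x, (c₂ ^ 2) ^ q * ∑' n, centeredMax μ (g n) x ^ q ∂μ :=
          mul_meas_ge_le_lintegral hMgm _
      _ = (c₂ ^ 2) ^ q * ∫⁻ x, ∑' n, centeredMax μ (g n) x ^ q ∂μ :=
          lintegral_const_mul' _ _ (by finiteness)
      _ ≤ (c₂ ^ 2) ^ q * (A * (l ^ (q - 1) * ((c₂ ^ (q - 1) + c₉ ^ q * c₅) * I))) := by
          gcongr
          exact hMg.trans (by gcongr)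
      _ = _ := by ring
  calc l * μ {x | l < (∑' n, centeredMax μ (φ n) x ^ q) ^ (1 / q)}
      ≤ l * (μ Fᶜ + μ T) := by
        gcongr
        exact (measure_mono hsub).trans (measure_union_le _ _)
    _ ≤ c₅ * I + (c₂ ^ 2) ^ q * (A * ((c₂ ^ (q - 1) + c₉ ^ q * c₅) * I)) := by
        rw [mul_add]
        exact add_le_add hweak hT
    _ = _ := by ring

end FeffermanStein

/-- Fefferman-Stein inequality, weak type `(1,1)`: if `(∑_n |f_n|^q)^{1/q} ∈ L¹(ℝ^d)`,
`1 < q < ∞`, then the vector-valued maximal function satisfies a weak `(1,1)` bound with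
constant depending only on `q` (and `d`). -/
theorem fefferman_stein_weak_type {d : ℕ} (q : ℝ) (hq : 1 < q) :
    ∃ C : ℝ, 0 < C ∧ ∀ f : ℕ → EuclideanSpace ℝ (Fin d) → ℝ,
      (∀ n, Measurable (f n)) →
      (∫⁻ x, (∑' n, (‖f n x‖₊ : ℝ≥0∞) ^ q) ^ (1 / q) ∂volume) < ⊤ →
      ∀ lam : ℝ, 0 < lam →
        volume {x | ENNReal.ofReal lam < (∑' n, (hlMax (f n) x) ^ q) ^ (1 / q)} ≤
          ENNReal.ofReal (C / lam) *
            ∫⁻ x, (∑' n, (‖f n x‖₊ : ℝ≥0∞) ^ q) ^ (1 / q) ∂volume := by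
  obtain ⟨K, hK, h⟩ := exists_mul_measure_lt_tsum_centeredMax_le
    (volume : Measure (EuclideanSpace ℝ (Fin d))) hq
  refine ⟨K.toReal + 1, by positivity, fun f hf hfin lam hlam => ?_⟩
  have hl0 : ENNReal.ofReal lam ≠ 0 := by simpa using hlam
  have hmain := h (fun n x => ‖f n x‖₊) (fun n => (hf n).nnnorm.coe_nnreal_ennreal) hfin.ne
    (ENNReal.ofReal lam) hl0 ENNReal.ofReal_ne_top
  rw [ENNReal.ofReal_div_of_pos hlam, ENNReal.mul_comm_div, ← mul_div_assoc,
    ENNReal.le_div_iff_mul_le (.inl hl0) (.inl ENNReal.ofReal_ne_top), mul_comm]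
  refine hmain.trans ?_
  gcongr
  rw [← ENNReal.ofReal_toReal hK]
  exact ENNReal.ofReal_le_ofReal (by simp)
end

section
/- Let $f=(f_n)_{n\in\mathbb{N}}$ be a sequence of measurable functions on $\mathbb{R}^d$ and let $1<p<+\infty$, $1<q<+\infty$. If the function $x\mapsto\left(\sum_{n=0}^{\infty}|f_n(x)|^q\right)^{1/q}$ belongs to $L^p(\mathbb{R}^d)$, then there is a constant $C=C(p,q,d)$, independent of $(f_n)_{n\in\mathbb{N}}$, such that $\left\| \left(\sum_{n=0}^{\infty}(Mf_n)^q\right)^{1/q} \right\|_{L^p(\mathbb{R}^d)} \leqslant C \left\| \left(\sum_{n=0}^{\infty}|f_n|^q\right)^{1/q} \right\|_{L^p(\mathbb{R}^d)}$. -/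
open MeasureTheory ENNReal

section MaximalFunction

open Metric Set

variable {d : ℕ}

/-- The centered Hardy-Littlewood maximal function of an extended nonnegative function. -/
noncomputable def maximalFunction (g : EuclideanSpace ℝ (Fin d) → ℝ≥0∞)
    (x : EuclideanSpace ℝ (Fin d)) : ℝ≥0∞ :=
  ⨆ (r : ℝ) (_ : 0 < r), (volume (ball x r))⁻¹ * ∫⁻ y in ball x r, g y

theorem lowerSemicontinuous_measure_ball {X : Type*} [PseudoMetricSpace X] [MeasurableSpace X]
    (ν : Measure X) (r : ℝ) : LowerSemicontinuous fun x => ν (ball x r) := by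
  intro x a ha
  obtain ⟨u, hu, hur, hut⟩ := exists_seq_strictMono_tendsto r
  have hunion : ball x r = ⋃ n, ball x (u n) := by
    ext y
    simp only [mem_ball, mem_iUnion]
    exact ⟨fun h => (hut.eventually (lt_mem_nhds h)).exists, fun ⟨n, hn⟩ => hn.trans (hur n)⟩
  have hmono : Monotone fun n => ball x (u n) := fun m n hmn => ball_subset_ball (hu.monotone hmn)
  replace ha : a < ν (ball x r) := ha
  rw [hunion, hmono.measure_iUnion] at ha
  obtain ⟨n, hn⟩ := lt_iSup_iff.1 ha
  filter_upwards [ball_mem_nhds x (sub_pos.2 (hur n))] with y hy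
  refine hn.trans_le (measure_mono (ball_subset_ball' ?_))
  rw [mem_ball, dist_comm] at hy
  linarith

theorem volume_ball_ne_zero (x : EuclideanSpace ℝ (Fin d)) {r : ℝ} (hr : 0 < r) :
    volume (ball x r) ≠ 0 :=
  (measure_ball_pos volume x hr).ne'

theorem volume_ball_ne_top (x : EuclideanSpace ℝ (Fin d)) (r : ℝ) : volume (ball x r) ≠ ⊤ :=
  measure_ball_lt_top.ne

theorem measurable_maximalFunction (g : EuclideanSpace ℝ (Fin d) → ℝ≥0∞) :
    Measurable (maximalFunction g) := by
  refine (lowerSemicontinuous_iSup fun r => lowerSemicontinuous_iSup fun hr => ?_ :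
    LowerSemicontinuous (maximalFunction g)).measurable
  simp only [Measure.addHaar_ball_center volume _ r]
  have h := lowerSemicontinuous_measure_ball
    (((volume (ball (0 : EuclideanSpace ℝ (Fin d)) r))⁻¹) • (volume.withDensity g)) r
  simpa [withDensity_apply g measurableSet_ball] using h

theorem lintegral_ball_le_mul_maximalFunction (g : EuclideanSpace ℝ (Fin d) → ℝ≥0∞)
    (x : EuclideanSpace ℝ (Fin d)) {r : ℝ} (hr : 0 < r) :
    ∫⁻ y in ball x r, g y ≤ volume (ball x r) * maximalFunction g x := by
  have h : (volume (ball x r))⁻¹ * ∫⁻ y in ball x r, g y ≤ maximalFunction g x :=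
    le_iSup₂_of_le r hr le_rfl
  exact (ENNReal.inv_mul_le_iff (volume_ball_ne_zero x hr) (volume_ball_ne_top x r)).1 h

theorem average_le_maximalFunction (g : EuclideanSpace ℝ (Fin d) → ℝ≥0∞)
    (x : EuclideanSpace ℝ (Fin d)) {r : ℝ} (hr : 0 < r) :
    (volume (ball x r))⁻¹ * ∫⁻ y in ball x r, g y ≤ maximalFunction g x :=
  le_iSup₂_of_le r hr le_rfl

theorem maximalFunction_le_iff {g : EuclideanSpace ℝ (Fin d) → ℝ≥0∞}
    {x : EuclideanSpace ℝ (Fin d)} {a : ℝ≥0∞} :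
    maximalFunction g x ≤ a ↔
      ∀ r : ℝ, 0 < r → (volume (ball x r))⁻¹ * ∫⁻ y in ball x r, g y ≤ a :=
  iSup₂_le_iff

theorem maximalFunction_mono_ae {g h : EuclideanSpace ℝ (Fin d) → ℝ≥0∞} (hgh : g ≤ᵐ[volume] h)
    (x : EuclideanSpace ℝ (Fin d)) : maximalFunction g x ≤ maximalFunction h x :=
  iSup₂_mono fun _ _ =>
    mul_le_mul_right (lintegral_mono_ae (ae_restrict_of_ae hgh)) _

theorem maximalFunction_const_le (c : ℝ≥0∞) (x : EuclideanSpace ℝ (Fin d)) :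
    maximalFunction (fun _ => c) x ≤ c := by
  refine maximalFunction_le_iff.2 fun r hr => ?_
  rw [setLIntegral_const, mul_comm c, ← mul_assoc,
    ENNReal.inv_mul_cancel (volume_ball_ne_zero x hr) (volume_ball_ne_top x r), one_mul]

theorem maximalFunction_tsum_le {g : ℕ → EuclideanSpace ℝ (Fin d) → ℝ≥0∞}
    (hg : ∀ n, Measurable (g n)) (x : EuclideanSpace ℝ (Fin d)) :
    maximalFunction (fun y => ∑' n, g n y) x ≤ ∑' n, maximalFunction (g n) x := by
  refine maximalFunction_le_iff.2 fun r hr => ?_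
  rw [lintegral_tsum fun n => (hg n).aemeasurable, ← ENNReal.tsum_mul_left]
  exact ENNReal.tsum_le_tsum fun n => average_le_maximalFunction _ x hr

theorem maximalFunction_add_le {g h : EuclideanSpace ℝ (Fin d) → ℝ≥0∞} (hg : Measurable g)
    (x : EuclideanSpace ℝ (Fin d)) :
    maximalFunction (fun y => g y + h y) x ≤ maximalFunction g x + maximalFunction h x := by
  refine maximalFunction_le_iff.2 fun r hr => ?_
  rw [lintegral_add_left hg, mul_add]
  exact add_le_add (average_le_maximalFunction _ x hr) (average_le_maximalFunction _ x hr)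

theorem maximalFunction_const_mul_le {g : EuclideanSpace ℝ (Fin d) → ℝ≥0∞} (hg : Measurable g)
    (c : ℝ≥0∞) (x : EuclideanSpace ℝ (Fin d)) :
    maximalFunction (fun y => c * g y) x ≤ c * maximalFunction g x := by
  refine maximalFunction_le_iff.2 fun r hr => ?_
  rw [lintegral_const_mul _ hg, mul_left_comm]
  gcongr
  exact average_le_maximalFunction _ x hr

theorem volume_ball_seven_mul (x y : EuclideanSpace ℝ (Fin d)) (r : ℝ) :
    volume (ball y (7 * r)) = 7 ^ d * volume (ball x r) := by
  rw [Measure.addHaar_ball_mul_of_pos volume y (by norm_num : (0 : ℝ) < 7) r,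
    Measure.addHaar_ball_center volume x r, finrank_euclideanSpace, Fintype.card_fin,
    ENNReal.ofReal_pow (by norm_num), ENNReal.ofReal_ofNat]

theorem mul_withDensity_closedBall_le {g w : EuclideanSpace ℝ (Fin d) → ℝ≥0∞} (hg : Measurable g)
    {l : ℝ≥0∞} {x : EuclideanSpace ℝ (Fin d)} {r : ℝ} (hr : 0 < r)
    (hl : l * volume (ball x r) ≤ ∫⁻ y in ball x r, g y) :
    l * volume.withDensity w (closedBall x (5 * r)) ≤
      7 ^ d * ∫⁻ y in ball x r, g y * maximalFunction w y := by
  set c := volume.withDensity w (closedBall x (5 * r))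
  have hc : ∀ y ∈ ball x r, c ≤ 7 ^ d * volume (ball x r) * maximalFunction w y := by
    intro y hy
    calc c ≤ volume.withDensity w (ball y (7 * r)) := by
          refine measure_mono (closedBall_subset_ball' ?_)
          rw [mem_ball, dist_comm] at hy
          linarith
      _ = ∫⁻ z in ball y (7 * r), w z := withDensity_apply w measurableSet_ball
      _ ≤ volume (ball y (7 * r)) * maximalFunction w y :=
          lintegral_ball_le_mul_maximalFunction w y (by positivity)
      _ = _ := by rw [volume_ball_seven_mul x]
  have h : volume (ball x r) * (l * c) ≤
      volume (ball x r) * (7 ^ d * ∫⁻ y in ball x r, g y * maximalFunction w y) := by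
    calc volume (ball x r) * (l * c) = (l * volume (ball x r)) * c := by ring
      _ ≤ (∫⁻ y in ball x r, g y) * c := by gcongr
      _ = ∫⁻ y in ball x r, g y * c := (lintegral_mul_const _ hg).symm
      _ ≤ ∫⁻ y in ball x r,
            (7 ^ d * volume (ball x r)) * (g y * maximalFunction w y) := by
          refine setLIntegral_mono' measurableSet_ball fun y hy => ?_
          calc g y * c ≤ g y * (7 ^ d * volume (ball x r) * maximalFunction w y) := by
                gcongr
                exact hc y hy
            _ = _ := by ring
      _ = _ := by
          rw [lintegral_const_mul (f := fun y => g y * maximalFunction w y) _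
            (hg.mul (measurable_maximalFunction w))]
          ring
  exact (ENNReal.mul_le_mul_iff_right (volume_ball_ne_zero x hr) (volume_ball_ne_top x r)).1 h

/-- The weighted weak type `(1,1)` inequality for the maximal function. -/
theorem mul_withDensity_lt_maximalFunction_le {g : EuclideanSpace ℝ (Fin d) → ℝ≥0∞}
    (hg : Measurable g) (w : EuclideanSpace ℝ (Fin d) → ℝ≥0∞) {l : ℝ≥0∞} :
    l * volume.withDensity w {x | l < maximalFunction g x} ≤
      7 ^ d * ∫⁻ y, g y * maximalFunction w y := by
  let s : ℕ → Set (EuclideanSpace ℝ (Fin d)) := fun R =>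
    {x | ∃ r : ℝ, 0 < r ∧ r ≤ R ∧ l * volume (ball x r) ≤ ∫⁻ y in ball x r, g y}
  have hs : Monotone s := fun m n hmn x ⟨r, h0, hr, h⟩ =>
    ⟨r, h0, hr.trans (by exact_mod_cast hmn), h⟩
  have hsub : {x | l < maximalFunction g x} ⊆ ⋃ R, s R := by
    intro x hx
    obtain ⟨r, hx⟩ := lt_iSup_iff.1 (show l < maximalFunction g x from hx)
    obtain ⟨hr, h⟩ := lt_iSup_iff.1 hx
    obtain ⟨R, hR⟩ := exists_nat_ge r
    refine mem_iUnion.2 ⟨R, r, hr, hR, ?_⟩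
    rw [mul_comm, ← div_eq_mul_inv] at h
    exact (ENNReal.le_div_iff_mul_le (Or.inl (volume_ball_ne_zero x hr))
      (Or.inl (volume_ball_ne_top x r))).1 h.le
  have hbound : ∀ R, l * volume.withDensity w (s R) ≤
      7 ^ d * ∫⁻ y, g y * maximalFunction w y := by
    intro R
    choose! r hr0 hrR hrl using fun x (hx : x ∈ s R) => hx
    obtain ⟨u, hus, hdisj, hcov⟩ := Vitali.exists_disjoint_subfamily_covering_enlargement_closedBall
      (s R) id r R hrR 5 (by norm_num)
    have hdisj' : u.PairwiseDisjoint fun a => ball a (r a) :=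
      hdisj.mono fun a => ball_subset_closedBall
    have hu : u.Countable := hdisj'.countable_of_isOpen (fun _ _ => isOpen_ball)
      fun a ha => nonempty_ball.2 (hr0 a (hus ha))
    have hsu : s R ⊆ ⋃ b ∈ u, closedBall b (5 * r b) := by
      intro x hx
      obtain ⟨b, hb, h⟩ := hcov x hx
      exact mem_biUnion hb (h (mem_closedBall_self (hr0 x hx).le))
    calc l * volume.withDensity w (s R)
        ≤ l * ∑' b : u, volume.withDensity w (closedBall (b : EuclideanSpace ℝ (Fin d)) (5 * r b)) := by
          gcongr
          exact (measure_mono hsu).trans (measure_biUnion_le _ hu _)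
      _ = ∑' b : u, l * volume.withDensity w (closedBall (b : EuclideanSpace ℝ (Fin d)) (5 * r b)) :=
          ENNReal.tsum_mul_left.symm
      _ ≤ ∑' b : u, 7 ^ d * ∫⁻ y in ball (b : EuclideanSpace ℝ (Fin d)) (r b),
            g y * maximalFunction w y :=
          ENNReal.tsum_le_tsum fun b =>
            mul_withDensity_closedBall_le hg (hr0 b (hus b.2)) (hrl b (hus b.2))
      _ = 7 ^ d * ∫⁻ y in ⋃ b ∈ u, ball b (r b), g y * maximalFunction w y := by
          rw [ENNReal.tsum_mul_left, lintegral_biUnion hu (fun _ _ => measurableSet_ball) hdisj']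
      _ ≤ 7 ^ d * ∫⁻ y, g y * maximalFunction w y := by
          gcongr
          exact Measure.restrict_le_self
  calc l * volume.withDensity w {x | l < maximalFunction g x}
      ≤ l * volume.withDensity w (⋃ R, s R) := by gcongr
    _ = ⨆ R, l * volume.withDensity w (s R) := by rw [hs.measure_iUnion, ENNReal.mul_iSup]
    _ ≤ _ := iSup_le hbound

theorem mul_rpow_sub_one_of_one_le {r : ℝ} (hr : 1 ≤ r) (a : ℝ≥0∞) : a * a ^ (r - 1) = a ^ r := by
  calc a * a ^ (r - 1) = a ^ (1 : ℝ) * a ^ (r - 1) := by rw [ENNReal.rpow_one]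
    _ = a ^ r := by
      rw [← ENNReal.rpow_add_of_nonneg _ _ zero_le_one (sub_nonneg.2 hr), add_sub_cancel]

theorem lintegral_Ioi_indicator_rpow {s : ℝ} (hs : 0 < s) (t : ℝ≥0∞) :
    ∫⁻ l in Ioi (0 : ℝ), {l : ℝ | ENNReal.ofReal l < t}.indicator
      (fun l => ENNReal.ofReal l ^ (s - 1)) l = ENNReal.ofReal (1 / s) * t ^ s := by
  have hfin : ∀ a : ℝ, 0 ≤ a → ∫⁻ l in Ioi (0 : ℝ), {l : ℝ | ENNReal.ofReal l < ENNReal.ofReal a}.indicator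
      (fun l => ENNReal.ofReal l ^ (s - 1)) l = ENNReal.ofReal (1 / s) * ENNReal.ofReal a ^ s := by
    intro a ha
    have hmeas : MeasurableSet {l : ℝ | ENNReal.ofReal l < ENNReal.ofReal a} :=
      measurableSet_lt ENNReal.measurable_ofReal measurable_const
    have hset : {l : ℝ | ENNReal.ofReal l < ENNReal.ofReal a} ∩ Ioi 0 = Ioo 0 a := by
      ext l
      simp only [mem_inter_iff, mem_ofPred_eq, mem_Ioi, mem_Ioo]
      constructor
      · exact fun ⟨h, h0⟩ => ⟨h0, ((ENNReal.ofReal_lt_ofReal_iff_of_nonneg h0.le).1 h)⟩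
      · exact fun ⟨h0, h⟩ => ⟨(ENNReal.ofReal_lt_ofReal_iff_of_nonneg h0.le).2 h, h0⟩
    have hloc : IntegrableOn (fun l : ℝ => l ^ (s - 1)) (Ioc 0 a) volume := by
      have := intervalIntegral.intervalIntegrable_rpow' (a := 0) (b := a) (r := s - 1) (by linarith)
      exact (intervalIntegrable_iff_integrableOn_Ioc_of_le ha).1 this
    rw [lintegral_indicator hmeas, Measure.restrict_restrict hmeas, hset,
      restrict_Ioo_eq_restrict_Ioc]
    calc ∫⁻ l in Ioc 0 a, ENNReal.ofReal l ^ (s - 1)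
        = ∫⁻ l in Ioc 0 a, ENNReal.ofReal (l ^ (s - 1)) :=
          setLIntegral_congr_fun measurableSet_Ioc fun l hl => ENNReal.ofReal_rpow_of_pos hl.1
      _ = ENNReal.ofReal (∫ l in Ioc 0 a, l ^ (s - 1)) := by
          refine (ofReal_integral_eq_lintegral_ofReal hloc ?_).symm
          filter_upwards [ae_restrict_mem measurableSet_Ioc] with l hl
          exact Real.rpow_nonneg hl.1.le _
      _ = ENNReal.ofReal (1 / s * a ^ s) := by
          rw [← intervalIntegral.integral_of_le ha, integral_rpow (Or.inl (by linarith)),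
            sub_add_cancel, Real.zero_rpow hs.ne']
          congr 1
          ring
      _ = _ := by
          rw [ENNReal.ofReal_mul (by positivity), ENNReal.ofReal_rpow_of_nonneg ha hs.le]
  rcases eq_or_ne t ⊤ with rfl | ht
  · have hc : ENNReal.ofReal (1 / s) ≠ 0 := by simpa using hs
    rw [ENNReal.top_rpow_of_pos hs, ENNReal.mul_top hc, ← top_le_iff]
    have hlim : Filter.Tendsto (fun n : ℕ => ENNReal.ofReal (1 / s) * ENNReal.ofReal n ^ s)
        Filter.atTop (nhds (ENNReal.ofReal (1 / s) * ⊤)) := by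
      refine ENNReal.Tendsto.const_mul ?_ (Or.inl (by simp))
      have h := (ENNReal.continuous_rpow_const (y := s)).tendsto ⊤
      rw [ENNReal.top_rpow_of_pos hs] at h
      simpa [Function.comp_def] using h.comp ENNReal.tendsto_nat_nhds_top
    rw [ENNReal.mul_top hc] at hlim
    refine le_of_tendsto' hlim fun n => ?_
    rw [← hfin n (by positivity)]
    refine lintegral_mono fun l => ?_
    exact indicator_le_indicator_of_subset (fun l _ => ENNReal.ofReal_lt_top) (fun _ => zero_le) l
  · have h := hfin t.toReal ENNReal.toReal_nonneg
    rwa [ENNReal.ofReal_toReal ht] at h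

theorem mul_withDensity_lt_maximalFunction_le_indicator {g : EuclideanSpace ℝ (Fin d) → ℝ≥0∞}
    (hg : Measurable g) (w : EuclideanSpace ℝ (Fin d) → ℝ≥0∞) (l : ℝ≥0∞) :
    l * volume.withDensity w {x | l < maximalFunction g x} ≤
      2 * 7 ^ d * ∫⁻ y, {y | l < 2 * g y}.indicator g y * maximalFunction w y := by
  set g₁ := {y | l < 2 * g y}.indicator g
  have hg₁ : Measurable g₁ := hg.indicator (measurableSet_lt measurable_const (hg.const_mul 2))
  have hle : ∀ y, g y ≤ g₁ y + l / 2 := by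
    intro y
    by_cases hy : l < 2 * g y
    · simp [g₁, indicator_of_mem (show y ∈ {y | l < 2 * g y} from hy)]
    · refine le_add_left ((ENNReal.le_div_iff_mul_le (by simp) (by simp)).2 ?_)
      rw [mul_comm]
      exact not_lt.1 hy
  have hM : ∀ x, maximalFunction g x ≤ maximalFunction g₁ x + l / 2 := fun x =>
    calc maximalFunction g x ≤ maximalFunction (fun y => g₁ y + l / 2) x :=
          maximalFunction_mono_ae (Filter.Eventually.of_forall hle) x
      _ ≤ maximalFunction g₁ x + maximalFunction (fun _ => l / 2) x :=
          maximalFunction_add_le hg₁ x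
      _ ≤ _ := by
          gcongr
          exact maximalFunction_const_le _ x
  have hsub : {x | l < maximalFunction g x} ⊆ {x | l / 2 < maximalFunction g₁ x} := by
    intro x hx
    by_contra h
    refine absurd (hM x) (not_le.2 (lt_of_le_of_lt ?_ hx))
    calc maximalFunction g₁ x + l / 2 ≤ l / 2 + l / 2 := by
          gcongr
          exact not_lt.1 h
      _ = l := ENNReal.add_halves l
  calc l * volume.withDensity w {x | l < maximalFunction g x}
      ≤ l * volume.withDensity w {x | l / 2 < maximalFunction g₁ x} := by gcongr
    _ = 2 * (l / 2 * volume.withDensity w {x | l / 2 < maximalFunction g₁ x}) := by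
        rw [← mul_assoc, ENNReal.mul_div_cancel (by simp) (by simp)]
    _ ≤ 2 * (7 ^ d * ∫⁻ y, g₁ y * maximalFunction w y) := by
        exact mul_le_mul_right (mul_withDensity_lt_maximalFunction_le hg₁ w) 2
    _ = _ := (mul_assoc _ _ _).symm

/-- The layer cake formula for powers of extended nonnegative functions. -/
theorem ofReal_mul_lintegral_rpow_mul {α : Type*} [MeasurableSpace α] {μ : Measure α} [SFinite μ]
    {s : ℝ} (hs : 0 < s) {g w : α → ℝ≥0∞} (hg : Measurable g) (hw : Measurable w) :
    ENNReal.ofReal (1 / s) * ∫⁻ x, g x ^ s * w x ∂μ =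
      ∫⁻ l in Ioi (0 : ℝ), ENNReal.ofReal l ^ (s - 1) *
        ∫⁻ x, {x | ENNReal.ofReal l < g x}.indicator w x ∂μ := by
  have hmeas : Measurable (Function.uncurry fun (x : α) (l : ℝ) =>
      {l : ℝ | ENNReal.ofReal l < g x}.indicator (fun l => ENNReal.ofReal l ^ (s - 1)) l * w x) := by
    have hset : MeasurableSet {z : α × ℝ | ENNReal.ofReal z.2 < g z.1} :=
      measurableSet_lt (by fun_prop) (by fun_prop)
    have h : Measurable fun z : α × ℝ => ENNReal.ofReal z.2 ^ (s - 1) := by fun_prop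
    exact (h.indicator hset).mul (hw.comp measurable_fst)
  calc ENNReal.ofReal (1 / s) * ∫⁻ x, g x ^ s * w x ∂μ
      = ∫⁻ x, ENNReal.ofReal (1 / s) * (g x ^ s * w x) ∂μ :=
        (lintegral_const_mul _ (by fun_prop)).symm
    _ = ∫⁻ x, ∫⁻ l in Ioi (0 : ℝ), {l : ℝ | ENNReal.ofReal l < g x}.indicator
          (fun l => ENNReal.ofReal l ^ (s - 1)) l * w x ∂volume ∂μ := by
        refine lintegral_congr fun x => ?_
        rw [lintegral_mul_const _ (Measurable.indicator (by fun_prop)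
          (measurableSet_lt ENNReal.measurable_ofReal measurable_const)),
          lintegral_Ioi_indicator_rpow hs, mul_assoc]
    _ = ∫⁻ l in Ioi (0 : ℝ), ∫⁻ x, {l : ℝ | ENNReal.ofReal l < g x}.indicator
          (fun l => ENNReal.ofReal l ^ (s - 1)) l * w x ∂μ :=
        lintegral_lintegral_swap hmeas.aemeasurable
    _ = _ := by
        refine lintegral_congr fun l => ?_
        rw [← lintegral_const_mul _ (hw.indicator (measurableSet_lt measurable_const hg))]
        refine lintegral_congr fun x => ?_
        by_cases h : ENNReal.ofReal l < g x <;> simp [indicator, h]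

/-- The weighted strong type inequality for the maximal function. -/
theorem exists_lintegral_maximalFunction_rpow_mul_le (d : ℕ) {q : ℝ} (hq : 1 < q) :
    ∃ C : ℝ≥0∞, C ≠ ⊤ ∧ ∀ g w : EuclideanSpace ℝ (Fin d) → ℝ≥0∞, Measurable g → Measurable w →
      ∫⁻ x, maximalFunction g x ^ q * w x ≤ C * ∫⁻ x, g x ^ q * maximalFunction w x := by
  have hq0 : 0 < q := by linarith
  have hq1 : 0 < q - 1 := by linarith
  refine ⟨ENNReal.ofReal q * (2 * 7 ^ d * (ENNReal.ofReal (1 / (q - 1)) * 2 ^ (q - 1))), ?_,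
    fun g w hg hw => ?_⟩
  · have : (2 : ℝ≥0∞) ^ (q - 1) ≠ ⊤ := ENNReal.rpow_ne_top_of_nonneg hq1.le (by simp)
    finiteness
  have hM := measurable_maximalFunction g
  have hMw := measurable_maximalFunction w
  have hkey : ENNReal.ofReal (1 / q) * ∫⁻ x, maximalFunction g x ^ q * w x ≤
      2 * 7 ^ d * (ENNReal.ofReal (1 / (q - 1)) * 2 ^ (q - 1)) *
        ∫⁻ x, g x ^ q * maximalFunction w x := by
    calc ENNReal.ofReal (1 / q) * ∫⁻ x, maximalFunction g x ^ q * w x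
        = ∫⁻ l in Ioi (0 : ℝ), ENNReal.ofReal l ^ (q - 1) *
            ∫⁻ x, {x | ENNReal.ofReal l < maximalFunction g x}.indicator w x :=
          ofReal_mul_lintegral_rpow_mul hq0 hM hw
      _ ≤ ∫⁻ l in Ioi (0 : ℝ), 2 * 7 ^ d * (ENNReal.ofReal l ^ (q - 1 - 1) *
            ∫⁻ x, {x | ENNReal.ofReal l < 2 * g x}.indicator
              (fun x => g x * maximalFunction w x) x) := by
          refine setLIntegral_mono' measurableSet_Ioi fun l hl => ?_
          have hset : MeasurableSet {x | ENNReal.ofReal l < maximalFunction g x} :=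
            measurableSet_lt measurable_const hM
          have h := mul_withDensity_lt_maximalFunction_le_indicator hg w (ENNReal.ofReal l)
          rw [withDensity_apply _ hset, ← lintegral_indicator hset] at h
          have hl0 : ENNReal.ofReal l ≠ 0 := by simpa using hl
          have hpow : ENNReal.ofReal l ^ (q - 1) =
              ENNReal.ofReal l ^ (q - 1 - 1) * ENNReal.ofReal l := by
            conv_rhs => rw [← ENNReal.rpow_one (ENNReal.ofReal l), ← ENNReal.rpow_mul, one_mul]
            rw [← ENNReal.rpow_add _ _ hl0 ENNReal.ofReal_ne_top, sub_add_cancel]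
          simp only [indicator_mul_left]
          rw [hpow, mul_assoc, mul_left_comm (2 * 7 ^ d)]
          gcongr
      _ = 2 * 7 ^ d * (ENNReal.ofReal (1 / (q - 1)) *
            ∫⁻ x, (2 * g x) ^ (q - 1) * (g x * maximalFunction w x)) := by
          rw [ofReal_mul_lintegral_rpow_mul (w := fun x => g x * maximalFunction w x) hq1
              (hg.const_mul 2) (hg.mul hMw),
            lintegral_const_mul' _ _ (by finiteness)]
      _ = 2 * 7 ^ d * (ENNReal.ofReal (1 / (q - 1)) *
            ∫⁻ x, 2 ^ (q - 1) * (g x ^ q * maximalFunction w x)) := by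
          congr! 4 with x
          rw [ENNReal.mul_rpow_of_nonneg _ _ hq1.le, mul_assoc, ← mul_assoc (g x ^ (q - 1)),
            mul_comm _ (g x), mul_rpow_sub_one_of_one_le hq.le]
      _ = _ := by
          rw [lintegral_const_mul (f := fun x => g x ^ q * maximalFunction w x) _
            ((hg.pow_const q).mul hMw)]
          ring
  calc ∫⁻ x, maximalFunction g x ^ q * w x
      = ENNReal.ofReal q * (ENNReal.ofReal (1 / q) * ∫⁻ x, maximalFunction g x ^ q * w x) := by
        rw [← mul_assoc, ← ENNReal.ofReal_mul hq0.le, mul_one_div_cancel hq0.ne',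
          ENNReal.ofReal_one, one_mul]
    _ ≤ _ := by
        rw [mul_assoc (ENNReal.ofReal q)]
        gcongr

theorem exists_lintegral_maximalFunction_rpow_le (d : ℕ) {q : ℝ} (hq : 1 < q) :
    ∃ C : ℝ≥0∞, C ≠ ⊤ ∧ ∀ g : EuclideanSpace ℝ (Fin d) → ℝ≥0∞, Measurable g →
      ∫⁻ x, maximalFunction g x ^ q ≤ C * ∫⁻ x, g x ^ q := by
  obtain ⟨C, hC, h⟩ := exists_lintegral_maximalFunction_rpow_mul_le d hq
  refine ⟨C, hC, fun g hg => ?_⟩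
  calc ∫⁻ x, maximalFunction g x ^ q = ∫⁻ x, maximalFunction g x ^ q * 1 := by simp
    _ ≤ C * ∫⁻ x, g x ^ q * maximalFunction (fun _ => 1) x := h g _ hg measurable_const
    _ ≤ C * ∫⁻ x, g x ^ q * 1 := by
        gcongr with x
        exact maximalFunction_const_le 1 x
    _ = _ := by simp

theorem maximalFunction_mul_le {s t : ℝ} (hst : s.HolderConjugate t)
    {g h : EuclideanSpace ℝ (Fin d) → ℝ≥0∞} (hg : Measurable g) (hh : Measurable h)
    (x : EuclideanSpace ℝ (Fin d)) :
    maximalFunction (fun y => g y * h y) x ≤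
      maximalFunction (fun y => g y ^ s) x ^ (1 / s) *
        maximalFunction (fun y => h y ^ t) x ^ (1 / t) := by
  refine maximalFunction_le_iff.2 fun r hr => ?_
  have hH := ENNReal.lintegral_mul_le_Lp_mul_Lq
    ((volume (ball x r))⁻¹ • (volume.restrict (ball x r))) hst hg.aemeasurable hh.aemeasurable
  simp only [lintegral_smul_measure, smul_eq_mul, Pi.mul_apply] at hH
  refine hH.trans ?_
  have hs := hst.nonneg
  have ht := hst.symm.nonneg
  gcongr <;> exact average_le_maximalFunction _ x hr

theorem maximalFunction_le_mul_rpow {s t : ℝ} (hst : s.HolderConjugate t)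
    {g u : EuclideanSpace ℝ (Fin d) → ℝ≥0∞} (hg : Measurable g) (hu : Measurable u)
    (hu0 : ∀ x, u x ≠ 0) (hut : ∀ᵐ x, u x ≠ ⊤) (x : EuclideanSpace ℝ (Fin d)) :
    maximalFunction g x ≤ maximalFunction (fun y => g y ^ s * u y ^ (1 - s)) x ^ (1 / s) *
      maximalFunction u x ^ (1 / t) := by
  have hg_eq : g ≤ᵐ[volume] fun y => (g y * u y ^ (-(1 / t))) * u y ^ (1 / t) := by
    filter_upwards [hut] with y hy
    rw [mul_assoc, ← ENNReal.rpow_add _ _ (hu0 y) hy, neg_add_cancel, ENNReal.rpow_zero, mul_one]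
  refine (maximalFunction_mono_ae hg_eq x).trans
    ((maximalFunction_mul_le hst (by fun_prop) (by fun_prop) x).trans_eq ?_)
  have hexp : -(1 / t) * s = 1 - s := by
    have := hst.symm.ne_zero
    have := hst.mul_eq_add
    field_simp
    linarith
  congr 3
  · ext y
    rw [ENNReal.mul_rpow_of_nonneg _ _ hst.nonneg, ← ENNReal.rpow_mul, hexp]
  · ext y
    rw [← ENNReal.rpow_mul, one_div_mul_cancel hst.symm.ne_zero, ENNReal.rpow_one]

theorem ae_eq_zero_of_maximalFunction_eq_zero {g : EuclideanSpace ℝ (Fin d) → ℝ≥0∞}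
    (hg : Measurable g) {x : EuclideanSpace ℝ (Fin d)} (hx : maximalFunction g x = 0) :
    g =ᵐ[volume] 0 := by
  rw [← lintegral_eq_zero_iff hg, ← setLIntegral_univ, ← iUnion_ball_nat_succ x,
    setLIntegral_iUnion_of_directed g
      (Monotone.directed_le fun m n hmn => ball_subset_ball (by gcongr))]
  refine iSup_eq_bot.2 fun n => le_zero_iff.1 ?_
  simpa [hx] using lintegral_ball_le_mul_maximalFunction g x (r := n + 1) (by positivity)

/-- The Rubio de Francia algorithm: every function is dominated by an `A₁` weight with comparable
`L^p` norm. -/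
theorem exists_majorant_maximalFunction_le (d : ℕ) {p : ℝ} (hp : 1 < p) :
    ∃ C : ℝ≥0∞, C ≠ ⊤ ∧ ∀ F : EuclideanSpace ℝ (Fin d) → ℝ≥0∞, Measurable F →
      ∃ u : EuclideanSpace ℝ (Fin d) → ℝ≥0∞, Measurable u ∧ F ≤ u ∧
        (∀ x, maximalFunction u x ≤ C * u x) ∧ ∫⁻ x, u x ^ p ≤ C * ∫⁻ x, F x ^ p := by
  have hp0 : 0 < p := by linarith
  obtain ⟨B, hB, hM⟩ := exists_lintegral_maximalFunction_rpow_le d hp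
  set A : ℝ≥0∞ := 1 + 2 * B
  have hA : A ≠ ⊤ := by finiteness
  have hA0 : A ≠ 0 := by simp [A]
  have hAp : 2 * B ≤ A ^ p := by
    calc 2 * B ≤ A := le_add_self
      _ = A ^ (1 : ℝ) := (ENNReal.rpow_one A).symm
      _ ≤ A ^ p := ENNReal.rpow_le_rpow_of_exponent_le le_self_add hp.le
  have hAp0 : A ^ p ≠ 0 := by simp [hA0, hp0.le, hp0]
  have hApt : A ^ p ≠ ⊤ := ENNReal.rpow_ne_top_of_nonneg hp0.le hA
  have hq : (A⁻¹) ^ p * B ≤ 2⁻¹ := by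
    rw [ENNReal.inv_rpow, ENNReal.inv_mul_le_iff hAp0 hApt, ← div_eq_mul_inv,
      ENNReal.le_div_iff_mul_le (by simp) (by simp), mul_comm]
    exact hAp
  refine ⟨2 * A + 2 ^ p * 2, ?_, fun F hF => ?_⟩
  · have : (2 : ℝ≥0∞) ^ p ≠ ⊤ := ENNReal.rpow_ne_top_of_nonneg hp0.le (by simp)
    finiteness
  let b : ℕ → EuclideanSpace ℝ (Fin d) → ℝ≥0∞ := fun k => maximalFunction^[k] F
  have hb_succ : ∀ k, b (k + 1) = maximalFunction (b k) := fun k =>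
    Function.iterate_succ_apply' _ _ _
  have hb : ∀ k, Measurable (b k) := by
    rintro (_ | k)
    · exact hF
    · rw [hb_succ]
      exact measurable_maximalFunction _
  have hbint : ∀ k, ∫⁻ x, b k x ^ p ≤ B ^ k * ∫⁻ x, F x ^ p := by
    intro k
    induction k with
    | zero => simp [b]
    | succ k ih =>
      rw [hb_succ, pow_succ', mul_assoc]
      exact (hM _ (hb k)).trans (by gcongr)
  refine ⟨fun x => ∑' k, ((2 * A)⁻¹) ^ k * b k x, by fun_prop, fun x => ?_, fun x => ?_, ?_⟩
  · exact (by simp [b] : F x = ((2 * A)⁻¹) ^ 0 * b 0 x).trans_le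
      (ENNReal.le_tsum (f := fun k => ((2 * A)⁻¹) ^ k * b k x) 0)
  · calc maximalFunction (fun x => ∑' k, ((2 * A)⁻¹) ^ k * b k x) x
        ≤ ∑' k, maximalFunction (fun x => ((2 * A)⁻¹) ^ k * b k x) x :=
          maximalFunction_tsum_le (fun k => by fun_prop) x
      _ ≤ ∑' k, ((2 * A)⁻¹) ^ k * b (k + 1) x := by
          refine ENNReal.tsum_le_tsum fun k => ?_
          rw [hb_succ]
          exact maximalFunction_const_mul_le (hb k) _ x
      _ = ∑' k, (2 * A) * (((2 * A)⁻¹) ^ (k + 1) * b (k + 1) x) := by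
          refine tsum_congr fun k => ?_
          rw [pow_succ', ← mul_assoc (2 * A), ← mul_assoc (2 * A),
            ENNReal.mul_inv_cancel (by simp [hA0]) (by finiteness), one_mul]
      _ = (2 * A) * ∑' k, ((2 * A)⁻¹) ^ (k + 1) * b (k + 1) x := ENNReal.tsum_mul_left
      _ ≤ (2 * A + 2 ^ p * 2) * ∑' k, ((2 * A)⁻¹) ^ k * b k x := by
          exact mul_le_mul' le_self_add (ENNReal.tsum_comp_le_tsum_of_injective
            (add_left_injective 1) fun k => ((2 * A)⁻¹) ^ k * b k x)
  · have hpt : ∀ x, (∑' k, ((2 * A)⁻¹) ^ k * b k x) ^ p ≤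
        2 ^ p * ∑' k, (((A⁻¹) ^ p) ^ k * b k x ^ p) := by
      intro x
      set s := ∑' k, (((A⁻¹) ^ p) ^ k * b k x ^ p)
      have hterm : ∀ k, ((2 * A)⁻¹) ^ k * b k x ≤ 2⁻¹ ^ k * s ^ (1 / p) := by
        intro k
        rw [ENNReal.mul_inv (by simp) (by simp), mul_pow, mul_assoc]
        gcongr
        rw [one_div, ENNReal.le_rpow_inv_iff hp0, ENNReal.mul_rpow_of_nonneg _ _ hp0.le,
          ← ENNReal.rpow_natCast, ← ENNReal.rpow_mul, mul_comm (k : ℝ), ENNReal.rpow_mul,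
          ENNReal.rpow_natCast]
        exact ENNReal.le_tsum k
      calc (∑' k, ((2 * A)⁻¹) ^ k * b k x) ^ p ≤ (∑' k : ℕ, 2⁻¹ ^ k * s ^ (1 / p)) ^ p :=
            ENNReal.rpow_le_rpow (ENNReal.tsum_le_tsum hterm) hp0.le
        _ = (2 * s ^ (1 / p)) ^ p := by
            rw [ENNReal.tsum_mul_right, ENNReal.tsum_geometric, ENNReal.one_sub_inv_two, inv_inv]
        _ = 2 ^ p * s := by
            rw [ENNReal.mul_rpow_of_nonneg _ _ hp0.le, ← ENNReal.rpow_mul,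
              one_div_mul_cancel hp0.ne', ENNReal.rpow_one]
    calc ∫⁻ x, (∑' k, ((2 * A)⁻¹) ^ k * b k x) ^ p
        ≤ ∫⁻ x, 2 ^ p * ∑' k, (((A⁻¹) ^ p) ^ k * b k x ^ p) := lintegral_mono hpt
      _ = 2 ^ p * ∑' k, ((A⁻¹) ^ p) ^ k * ∫⁻ x, b k x ^ p := by
          rw [lintegral_const_mul _ (by fun_prop), lintegral_tsum fun k => by fun_prop]
          congr! 3 with k
          exact lintegral_const_mul _ (by fun_prop)
      _ ≤ 2 ^ p * ∑' k : ℕ, 2⁻¹ ^ k * ∫⁻ x, F x ^ p := by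
          gcongr 2 ^ p * ?_
          refine ENNReal.tsum_le_tsum fun k => ?_
          calc ((A⁻¹) ^ p) ^ k * ∫⁻ x, b k x ^ p
              ≤ ((A⁻¹) ^ p) ^ k * (B ^ k * ∫⁻ x, F x ^ p) := by
                gcongr
                exact hbint k
            _ = ((A⁻¹) ^ p * B) ^ k * ∫⁻ x, F x ^ p := by rw [mul_pow, mul_assoc]
            _ ≤ _ := by gcongr
      _ = 2 ^ p * 2 * ∫⁻ x, F x ^ p := by
          rw [ENNReal.tsum_mul_right, ENNReal.tsum_geometric, ENNReal.one_sub_inv_two, inv_inv,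
            mul_assoc]
      _ ≤ _ := by
          gcongr
          exact le_add_self

theorem rpow_div_le_mul_rpow_sub_add {p q : ℝ} (hp : 0 < p) (hpq : p < q) {a u : ℝ≥0∞}
    (hu0 : u ≠ 0) (hut : u ≠ ⊤) : a ^ (p / q) ≤ a * u ^ (p - q) + u ^ p := by
  have hq : 0 < q := hp.trans hpq
  rcases le_or_gt a (u ^ q) with h | h
  · refine le_add_left ?_
    calc a ^ (p / q) ≤ (u ^ q) ^ (p / q) := by gcongr
      _ = u ^ p := by rw [← ENNReal.rpow_mul, mul_div_cancel₀ _ hq.ne']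
  · refine le_add_right ?_
    have ha0 : a ≠ 0 := (zero_le.trans_lt h).ne'
    rcases eq_or_ne a ⊤ with rfl | hat
    · rw [ENNReal.top_mul (by simp [ENNReal.rpow_eq_zero_iff, hu0, hut])]
      exact le_top
    have hexp : p / q = 1 + -((q - p) / q) := by field_simp; ring
    calc a ^ (p / q) = a * (a ^ ((q - p) / q))⁻¹ := by
          rw [hexp, ENNReal.rpow_add _ _ ha0 hat, ENNReal.rpow_one, ENNReal.rpow_neg]
      _ ≤ a * ((u ^ q) ^ ((q - p) / q))⁻¹ := by
          have : 0 ≤ (q - p) / q := div_nonneg (by linarith) hq.le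
          gcongr
      _ = a * u ^ (p - q) := by
          rw [← ENNReal.rpow_mul, mul_div_cancel₀ _ hq.ne', ← ENNReal.rpow_neg, neg_sub]

/-- The vector-valued maximal inequality for `p < q`. -/
theorem exists_lintegral_tsum_maximalFunction_le_of_lt (d : ℕ) {p q : ℝ} (hp : 1 < p)
    (hpq : p < q) : ∃ C : ℝ≥0∞, C ≠ ⊤ ∧ ∀ g : ℕ → EuclideanSpace ℝ (Fin d) → ℝ≥0∞,
      (∀ n, Measurable (g n)) → ∫⁻ x, (∑' n, g n x ^ q) ^ (p / q) ≠ ⊤ →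
      ∫⁻ x, (∑' n, maximalFunction (g n) x ^ q) ^ (p / q) ≤
        C * ∫⁻ x, (∑' n, g n x ^ q) ^ (p / q) := by
  have hp0 : 0 < p := by linarith
  have hq0 : 0 < q := by linarith
  have hqp : 0 < q - p := by linarith
  obtain ⟨B, hB, hM⟩ := exists_lintegral_maximalFunction_rpow_le d hp
  obtain ⟨A, hA, hR⟩ := exists_majorant_maximalFunction_le d hp
  refine ⟨A ^ (q - p) * B + A, ?_, fun g hg hfin => ?_⟩
  · have := ENNReal.rpow_ne_top_of_nonneg hqp.le hA
    finiteness
  obtain ⟨u, hu, hFu, hMu, hup⟩ := hR (fun x => (∑' n, g n x ^ q) ^ (1 / q)) (by fun_prop)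
  have hFp : ∀ x, ((∑' n, g n x ^ q) ^ (1 / q)) ^ p = (∑' n, g n x ^ q) ^ (p / q) := fun x => by
    rw [← ENNReal.rpow_mul, one_div_mul_eq_div]
  simp only [hFp] at hup
  have hgu : ∀ n x, g n x ≤ u x := fun n x => by
    refine le_trans ?_ (hFu x)
    rw [one_div, ENNReal.le_rpow_inv_iff hq0]
    exact ENNReal.le_tsum n
  by_cases h0 : ∃ x, u x = 0
  · obtain ⟨x₀, hx₀⟩ := h0
    have hu0 : u =ᵐ[volume] 0 := ae_eq_zero_of_maximalFunction_eq_zero hu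
      (le_zero_iff.1 ((hMu x₀).trans_eq (by rw [hx₀, mul_zero])))
    have hMg : ∀ n x, maximalFunction (g n) x = 0 := fun n x => by
      refine le_zero_iff.1 (le_trans (maximalFunction_mono_ae ?_ x) (maximalFunction_const_le 0 x))
      filter_upwards [hu0] with y hy
      exact (hgu n y).trans_eq hy
    simp [hMg, hq0, div_pos hp0 hq0]
  push Not at h0
  have hut : ∀ᵐ x, u x ≠ ⊤ := by
    have h := ae_lt_top (μ := volume) (hu.pow_const p)
      (ne_top_of_le_ne_top (ENNReal.mul_ne_top hA hfin) hup)
    filter_upwards [h] with x hx hx'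
    simp [hx', hp0] at hx
  have hconj : (q / p).HolderConjugate (q / (q - p)) := by
    rw [Real.holderConjugate_iff]
    refine ⟨(one_lt_div hp0).2 hpq, ?_⟩
    field_simp
    ring
  have hterm : ∀ n, ∫⁻ x, maximalFunction (g n) x ^ q * u x ^ (p - q) ≤
      A ^ (q - p) * B * ∫⁻ x, g n x ^ q * u x ^ (p - q) := by
    intro n
    set h : EuclideanSpace ℝ (Fin d) → ℝ≥0∞ := fun y => g n y ^ (q / p) * u y ^ (1 - q / p)
    have hh : Measurable h := by fun_prop
    have hhp : ∀ x, h x ^ p = g n x ^ q * u x ^ (p - q) := fun x => by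
      rw [ENNReal.mul_rpow_of_nonneg _ _ hp0.le, ← ENNReal.rpow_mul, ← ENNReal.rpow_mul,
        div_mul_cancel₀ _ hp0.ne', sub_mul, div_mul_cancel₀ _ hp0.ne', one_mul]
    calc ∫⁻ x, maximalFunction (g n) x ^ q * u x ^ (p - q)
        ≤ ∫⁻ x, A ^ (q - p) * maximalFunction h x ^ p := by
          refine lintegral_mono_ae ?_
          filter_upwards [hut] with x hx
          calc maximalFunction (g n) x ^ q * u x ^ (p - q)
              ≤ (maximalFunction h x ^ (1 / (q / p)) *
                  maximalFunction u x ^ (1 / (q / (q - p)))) ^ q * u x ^ (p - q) := by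
                gcongr
                exact maximalFunction_le_mul_rpow hconj (hg n) hu h0 hut x
            _ = maximalFunction h x ^ p * maximalFunction u x ^ (q - p) * u x ^ (p - q) := by
                rw [ENNReal.mul_rpow_of_nonneg _ _ hq0.le, ← ENNReal.rpow_mul,
                  ← ENNReal.rpow_mul, one_div_div, one_div_div, div_mul_cancel₀ _ hq0.ne',
                  div_mul_cancel₀ _ hq0.ne']
            _ ≤ maximalFunction h x ^ p * (A * u x) ^ (q - p) * u x ^ (p - q) := by
                gcongr
                exact hMu x
            _ = A ^ (q - p) * maximalFunction h x ^ p * (u x ^ (q - p) * u x ^ (p - q)) := by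
                rw [ENNReal.mul_rpow_of_nonneg _ _ hqp.le]
                ring
            _ = A ^ (q - p) * maximalFunction h x ^ p := by
                rw [← ENNReal.rpow_add _ _ (h0 x) hx, sub_add_sub_cancel', sub_self,
                  ENNReal.rpow_zero, mul_one]
      _ = A ^ (q - p) * ∫⁻ x, maximalFunction h x ^ p :=
          lintegral_const_mul _ ((measurable_maximalFunction h).pow_const p)
      _ ≤ A ^ (q - p) * (B * ∫⁻ x, h x ^ p) := by
          gcongr
          exact hM h hh
      _ = _ := by simp only [hhp, mul_assoc]
  have hS : ∫⁻ x, (∑' n, g n x ^ q) * u x ^ (p - q) ≤ ∫⁻ x, (∑' n, g n x ^ q) ^ (p / q) := by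
    refine lintegral_mono_ae ?_
    filter_upwards [hut] with x hx
    have hexp : (1 : ℝ) = p / q + 1 / q * (q - p) := by field_simp; ring
    calc (∑' n, g n x ^ q) * u x ^ (p - q)
        = (∑' n, g n x ^ q) ^ (p / q) * ((∑' n, g n x ^ q) ^ (1 / q)) ^ (q - p) *
            u x ^ (p - q) := by
          rw [← ENNReal.rpow_mul, ← ENNReal.rpow_add_of_nonneg _ _ (by positivity) (by positivity),
            ← hexp, ENNReal.rpow_one]
      _ ≤ (∑' n, g n x ^ q) ^ (p / q) * u x ^ (q - p) * u x ^ (p - q) := by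
          gcongr
          exact hFu x
      _ = _ := by
          rw [mul_assoc, ← ENNReal.rpow_add _ _ (h0 x) hx, sub_add_sub_cancel', sub_self,
            ENNReal.rpow_zero, mul_one]
  have hMm : ∀ n, Measurable (maximalFunction (g n)) := fun n => measurable_maximalFunction _
  calc ∫⁻ x, (∑' n, maximalFunction (g n) x ^ q) ^ (p / q)
      ≤ ∫⁻ x, ((∑' n, maximalFunction (g n) x ^ q) * u x ^ (p - q) + u x ^ p) := by
        refine lintegral_mono_ae ?_
        filter_upwards [hut] with x hx
        exact rpow_div_le_mul_rpow_sub_add hp0 hpq (h0 x) hx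
    _ = (∑' n, ∫⁻ x, maximalFunction (g n) x ^ q * u x ^ (p - q)) + ∫⁻ x, u x ^ p := by
        rw [lintegral_add_right _ (by fun_prop), ← lintegral_tsum fun n => by fun_prop]
        simp only [ENNReal.tsum_mul_right]
    _ ≤ (∑' n, A ^ (q - p) * B * ∫⁻ x, g n x ^ q * u x ^ (p - q)) +
          A * ∫⁻ x, (∑' n, g n x ^ q) ^ (p / q) :=
        add_le_add (ENNReal.tsum_le_tsum hterm) hup
    _ = A ^ (q - p) * B * (∫⁻ x, (∑' n, g n x ^ q) * u x ^ (p - q)) +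
          A * ∫⁻ x, (∑' n, g n x ^ q) ^ (p / q) := by
        rw [ENNReal.tsum_mul_left, ← lintegral_tsum fun n => by fun_prop]
        simp only [ENNReal.tsum_mul_right]
    _ ≤ _ := by
        rw [add_mul]
        gcongr

theorem lintegral_rpow_le_of_forall_le {α : Type*} [MeasurableSpace α] {μ : Measure α}
    [SigmaFinite μ] {r : ℝ} (hr : 0 < r) {f : α → ℝ≥0∞} (hf : Measurable f) {b : ℝ≥0∞}
    (h : ∀ g : α → ℝ≥0∞, Measurable g → g ≤ f → ∫⁻ x, g x ^ r ∂μ ≠ ⊤ → ∫⁻ x, g x ^ r ∂μ ≤ b) :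
    ∫⁻ x, f x ^ r ∂μ ≤ b := by
  let g : ℕ → α → ℝ≥0∞ := fun k => (spanningSets μ k).indicator fun x => min (f x) k
  have hg : ∀ k, Measurable (g k) := fun k =>
    (hf.min measurable_const).indicator (measurableSet_spanningSets μ k)
  have hgf : ∀ k, g k ≤ f := fun k => indicator_le fun x _ => min_le_left (f x) (k : ℝ≥0∞)
  have hmono : ∀ x, Monotone fun k => g k x ^ r := by
    intro x m n hmn
    refine ENNReal.rpow_le_rpow ?_ hr.le
    exact (indicator_le_indicator_of_subset (monotone_spanningSets μ hmn)
      (fun _ => zero_le) x).trans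
      (indicator_le_indicator (min_le_min_left (f x) (Nat.cast_le.2 hmn)))
  have htend : ∀ x, Filter.Tendsto (fun k => g k x ^ r) Filter.atTop (nhds (f x ^ r)) := by
    intro x
    refine (ENNReal.continuous_rpow_const.tendsto (f x)).comp ?_
    have hmin : Filter.Tendsto (fun k : ℕ => min (f x) (k : ℝ≥0∞)) Filter.atTop (nhds (f x)) := by
      simpa using (tendsto_const_nhds (x := f x)).min ENNReal.tendsto_nat_nhds_top
    refine hmin.congr' ?_
    filter_upwards [Filter.eventually_ge_atTop (spanningSetsIndex μ x)] with k hk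
    exact (indicator_of_mem (mem_spanningSets_of_index_le μ x hk)
      fun x => min (f x) (k : ℝ≥0∞)).symm
  refine le_of_tendsto' (lintegral_tendsto_of_tendsto_of_monotone
    (fun k => ((hg k).pow_const r).aemeasurable) (.of_forall hmono) (.of_forall htend))
    fun k => h (g k) (hg k) (hgf k) ?_
  refine ne_top_of_le_ne_top ?_ (lintegral_mono (g := (spanningSets μ k).indicator
    fun _ => (k : ℝ≥0∞) ^ r) fun x => ?_)
  · rw [lintegral_indicator_const (measurableSet_spanningSets μ k)]
    exact ENNReal.mul_ne_top (ENNReal.rpow_ne_top_of_nonneg hr.le (by simp))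
      (measure_spanningSets_lt_top μ k).ne
  · by_cases hx : x ∈ spanningSets μ k
    · simp only [g, indicator_of_mem hx]
      gcongr
      exact min_le_right _ _
    · simp [g, indicator_of_notMem hx, hr]

/-- The vector-valued maximal inequality for `q < p`. -/
theorem exists_lintegral_tsum_maximalFunction_le_of_gt (d : ℕ) {p q : ℝ} (hq : 1 < q)
    (hqp : q < p) : ∃ C : ℝ≥0∞, C ≠ ⊤ ∧ ∀ g : ℕ → EuclideanSpace ℝ (Fin d) → ℝ≥0∞,
      (∀ n, Measurable (g n)) →
      ∫⁻ x, (∑' n, maximalFunction (g n) x ^ q) ^ (p / q) ≤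
        C * ∫⁻ x, (∑' n, g n x ^ q) ^ (p / q) := by
  have hq0 : 0 < q := by linarith
  have hr : 1 < p / q := (one_lt_div hq0).2 hqp
  set r := p / q
  have hr0 : 0 < r := by linarith
  have hconj : r.HolderConjugate r.conjExponent := Real.HolderConjugate.conjExponent hr
  set s := r.conjExponent
  have hs0 : 0 < s := hconj.symm.pos
  obtain ⟨A, hA, hW⟩ := exists_lintegral_maximalFunction_rpow_mul_le d hq
  obtain ⟨B, hB, hM⟩ := exists_lintegral_maximalFunction_rpow_le d hconj.symm.lt
  refine ⟨(A * B ^ (1 / s)) ^ r, ?_, fun g hg => ?_⟩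
  · exact ENNReal.rpow_ne_top_of_nonneg hr0.le (ENNReal.mul_ne_top hA
      (ENNReal.rpow_ne_top_of_nonneg (by positivity) hB))
  have hMm : ∀ n, Measurable (maximalFunction (g n)) := fun n => measurable_maximalFunction _
  refine lintegral_rpow_le_of_forall_le hr0 (by fun_prop) fun h hh hle hfin => ?_
  set I := ∫⁻ x, h x ^ r
  rcases eq_or_ne I 0 with hI | hI
  · simp [hI]
  set w : EuclideanSpace ℝ (Fin d) → ℝ≥0∞ := fun x => h x ^ (r - 1)
  have hw : Measurable w := by fun_prop
  have hMw := measurable_maximalFunction w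
  have hws : ∀ x, w x ^ s = h x ^ r := fun x => by
    rw [← ENNReal.rpow_mul, hconj.sub_one_mul_conj]
  have hbound : I ≤ A * B ^ (1 / s) * (∫⁻ x, (∑' n, g n x ^ q) ^ r) ^ (1 / r) * I ^ (1 / s) := by
    calc I ≤ ∫⁻ x, (∑' n, maximalFunction (g n) x ^ q) * w x := by
          refine lintegral_mono fun x => ?_
          calc h x ^ r = h x * w x := (mul_rpow_sub_one_of_one_le hr.le _).symm
            _ ≤ _ := by
                gcongr
                exact hle x
      _ = ∑' n, ∫⁻ x, maximalFunction (g n) x ^ q * w x := by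
          rw [← lintegral_tsum fun n => by fun_prop]
          simp only [ENNReal.tsum_mul_right]
      _ ≤ ∑' n, A * ∫⁻ x, g n x ^ q * maximalFunction w x :=
          ENNReal.tsum_le_tsum fun n => hW _ _ (hg n) hw
      _ = A * ∫⁻ x, (∑' n, g n x ^ q) * maximalFunction w x := by
          rw [ENNReal.tsum_mul_left, ← lintegral_tsum fun n => by fun_prop]
          simp only [ENNReal.tsum_mul_right]
      _ ≤ A * ((∫⁻ x, (∑' n, g n x ^ q) ^ r) ^ (1 / r) *
            (∫⁻ x, maximalFunction w x ^ s) ^ (1 / s)) := by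
          gcongr
          exact ENNReal.lintegral_mul_le_Lp_mul_Lq volume hconj
            (f := fun x => ∑' n, g n x ^ q) (by fun_prop) hMw.aemeasurable
      _ ≤ A * ((∫⁻ x, (∑' n, g n x ^ q) ^ r) ^ (1 / r) * (B * ∫⁻ x, w x ^ s) ^ (1 / s)) := by
          gcongr
          exact hM w hw
      _ = _ := by
          rw [ENNReal.mul_rpow_of_nonneg _ _ (by positivity)]
          simp only [hws]
          ring
  have hsplit : I = I ^ (1 / r) * I ^ (1 / s) := by
    rw [← ENNReal.rpow_add _ _ hI hfin, one_div, one_div, hconj.inv_add_inv_eq_one,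
      ENNReal.rpow_one]
  have hIs0 : I ^ (1 / s) ≠ 0 := by simp [hI, hfin]
  have hIst : I ^ (1 / s) ≠ ⊤ := ENNReal.rpow_ne_top_of_nonneg (by positivity) hfin
  have hroot : I ^ (1 / r) ≤ A * B ^ (1 / s) * (∫⁻ x, (∑' n, g n x ^ q) ^ r) ^ (1 / r) :=
    (ENNReal.mul_le_mul_iff_left hIs0 hIst).1 (hsplit.symm.trans_le hbound)
  calc I = (I ^ (1 / r)) ^ r := by
        rw [← ENNReal.rpow_mul, one_div_mul_cancel hr0.ne', ENNReal.rpow_one]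
    _ ≤ (A * B ^ (1 / s) * (∫⁻ x, (∑' n, g n x ^ q) ^ r) ^ (1 / r)) ^ r := by gcongr
    _ = _ := by
        rw [ENNReal.mul_rpow_of_nonneg _ _ hr0.le, ← ENNReal.rpow_mul (∫⁻ x, _),
          one_div_mul_cancel hr0.ne', ENNReal.rpow_one]

/-- The vector-valued maximal inequality for extended nonnegative functions. -/
theorem exists_lintegral_tsum_maximalFunction_le (d : ℕ) {p q : ℝ} (hp : 1 < p) (hq : 1 < q) :
    ∃ C : ℝ≥0∞, C ≠ ⊤ ∧ ∀ g : ℕ → EuclideanSpace ℝ (Fin d) → ℝ≥0∞,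
      (∀ n, Measurable (g n)) → ∫⁻ x, (∑' n, g n x ^ q) ^ (p / q) ≠ ⊤ →
      ∫⁻ x, (∑' n, maximalFunction (g n) x ^ q) ^ (p / q) ≤
        C * ∫⁻ x, (∑' n, g n x ^ q) ^ (p / q) := by
  rcases lt_trichotomy p q with hpq | rfl | hpq
  · exact exists_lintegral_tsum_maximalFunction_le_of_lt d hp hpq
  · obtain ⟨C, hC, h⟩ := exists_lintegral_maximalFunction_rpow_le d hp
    refine ⟨C, hC, fun g hg _ => ?_⟩
    have hMm : ∀ n, Measurable (maximalFunction (g n)) := fun n => measurable_maximalFunction _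
    simp only [div_self (zero_lt_one.trans hp).ne', ENNReal.rpow_one]
    rw [lintegral_tsum fun n => by fun_prop, lintegral_tsum fun n => by fun_prop,
      ← ENNReal.tsum_mul_left]
    exact ENNReal.tsum_le_tsum fun n => h _ (hg n)
  · obtain ⟨C, hC, h⟩ := exists_lintegral_tsum_maximalFunction_le_of_gt d hq hpq
    exact ⟨C, hC, fun g hg _ => h g hg⟩

end MaximalFunction

/-- Fefferman-Stein inequality, strong type `(p,p)`: if `(∑_n |f_n|^q)^{1/q} ∈ L^p(ℝ^d)`,
`1 < p, q < ∞`, then `‖(∑_n (M f_n)^q)^{1/q}‖_{L^p} ≤ C ‖(∑_n |f_n|^q)^{1/q}‖_{L^p}` with a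
constant depending only on `p`, `q` (and `d`). -/
theorem fefferman_stein_strong_type {d : ℕ} (p q : ℝ) (hp : 1 < p) (hq : 1 < q) :
    ∃ C : ℝ, 0 < C ∧ ∀ f : ℕ → EuclideanSpace ℝ (Fin d) → ℝ,
      (∀ n, Measurable (f n)) →
      (∫⁻ x, (∑' n, (‖f n x‖₊ : ℝ≥0∞) ^ q) ^ (p / q) ∂volume) < ⊤ →
      (∫⁻ x, (∑' n, (hlMax (f n) x) ^ q) ^ (p / q) ∂volume) ^ (1 / p) ≤
        ENNReal.ofReal C *
          (∫⁻ x, (∑' n, (‖f n x‖₊ : ℝ≥0∞) ^ q) ^ (p / q) ∂volume) ^ (1 / p) := by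
  have hp0 : 0 ≤ 1 / p := by positivity
  obtain ⟨C, hC, h⟩ := exists_lintegral_tsum_maximalFunction_le d hp hq
  have hCt : C ^ (1 / p) ≠ ⊤ := ENNReal.rpow_ne_top_of_nonneg hp0 hC
  refine ⟨(C ^ (1 / p)).toReal + 1, by positivity, fun f hf hfin => ?_⟩
  calc (∫⁻ x, (∑' n, (hlMax (f n) x) ^ q) ^ (p / q) ∂volume) ^ (1 / p)
      ≤ (C * ∫⁻ x, (∑' n, (‖f n x‖₊ : ℝ≥0∞) ^ q) ^ (p / q) ∂volume) ^ (1 / p) :=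
        ENNReal.rpow_le_rpow (h (fun n x => (‖f n x‖₊ : ℝ≥0∞))
          (fun n => (hf n).nnnorm.coe_nnreal_ennreal) hfin.ne) hp0
    _ = C ^ (1 / p) *
          (∫⁻ x, (∑' n, (‖f n x‖₊ : ℝ≥0∞) ^ q) ^ (p / q) ∂volume) ^ (1 / p) :=
        ENNReal.mul_rpow_of_nonneg _ _ hp0
    _ ≤ _ := by
        gcongr
        rw [ENNReal.ofReal_add ENNReal.toReal_nonneg zero_le_one, ENNReal.ofReal_toReal hCt]
        exact le_self_add
end
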